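/- arXiv:2008.01417 — 3 statements merged into one kernel-verified Lean document; each statement's English description precedes it below -/
import Mathlib

section
/- Let m > 1, d ≥ 2, t be integers with gcd(d,m) = 1 and gcd(d,t) = 1. Then the sum over k from 0 to m−1 of [2dk+t]_{q^2} · [2dk+t]^2 · (q^{2t};q^{2d})_k^2 (aq^{2t};q^{2d})_k (q^{2t}/a;q^{2d})_k / ((q^{2d};q^{2d})_k^2 (aq^{2d};q^{2d})_k (q^{2d}/a;q^{2d})_k) · q^{−4tk} is congruent to 0 modulo Φ_m(q^2), as an identity of rational functions in a and q. -/
open Polynomial Finset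

/-- The q-shifted factorial `(x; r)_k = (1-x)(1-x r)⋯(1-x r^(k-1))`. -/
noncomputable def qPoch {F : Type*} [Field F] (x r : F) (k : ℕ) : F :=
  ∏ i ∈ Finset.range k, (1 - x * r ^ i)

/-- The q-integer `[z] = (1-q^z)/(1-q)` (for an arbitrary integer `z`). -/
noncomputable def qInt {F : Type*} [Field F] (q : F) (z : ℤ) : F :=
  (1 - q ^ z) / (1 - q)

/-- The rational function `x ∈ ℚ(a)(q)` is ≡ 0 modulo the polynomial `M ∈ ℚ(a)[q]`:
its numerator in lowest terms is divisible by `M`, i.e. `x = M·f/g` with `g` coprime to `M`.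
Here the coefficient field `RatFunc ℚ` is the field of rational functions in `a`. -/
def ratCongr2 (M : Polynomial (RatFunc ℚ)) (x : RatFunc (RatFunc ℚ)) : Prop :=
  ∃ f g : Polynomial (RatFunc ℚ), IsCoprime M g ∧
    x * algebraMap (Polynomial (RatFunc ℚ)) (RatFunc (RatFunc ℚ)) g =
      algebraMap (Polynomial (RatFunc ℚ)) (RatFunc (RatFunc ℚ)) M *
        algebraMap (Polynomial (RatFunc ℚ)) (RatFunc (RatFunc ℚ)) f

/-- Product formula behind the reversal `k ↦ r - k` of the summation index. -/
lemma pow_mul_qPoch_mul_qPoch_reflect {L : Type*} [Field L] {p u b : L} (hb : b ≠ 0) (r : ℕ)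
    (hu : p ^ r * u = 1) (k j : ℕ) (hkj : k + j = r) :
    p ^ (2 * j * k + k * (k + 1)) * (qPoch (b * u) p k * qPoch (u / b) p k) *
      (qPoch (b * p) p j * qPoch (p / b) p j) = qPoch (b * p) p r * qPoch (p / b) p r := by
  induction k generalizing j with
  | zero =>
    obtain rfl : j = r := by omega
    simp [qPoch]
  | succ k ih =>
    rw [← ih (j + 1) (by omega)]
    have hv : p ^ k * u * p ^ (j + 1) = 1 := by
      rw [← hu, ← hkj]; ring
    have hstep : (p ^ (j + 1)) ^ 2 * ((1 - b * u * p ^ k) * (1 - u / b * p ^ k)) =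
        (1 - b * p * p ^ j) * (1 - p / b * p ^ j) := by
      have h1 : p ^ (j + 1) * (1 - b * u * p ^ k) = p ^ (j + 1) - b := by
        linear_combination -b * hv
      have h2 : p ^ (j + 1) * (1 - u / b * p ^ k) = p ^ (j + 1) - 1 / b := by
        linear_combination (-1 / b) * hv
      calc _ = (p ^ (j + 1) * (1 - b * u * p ^ k)) * (p ^ (j + 1) * (1 - u / b * p ^ k)) := by ring
        _ = _ := by rw [h1, h2]; field_simp; ring
    have hN (x : L) : qPoch x p (k + 1) = qPoch x p k * (1 - x * p ^ k) :=
      Finset.prod_range_succ _ _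
    have hD (x : L) : qPoch x p (j + 1) = qPoch x p j * (1 - x * p ^ j) :=
      Finset.prod_range_succ _ _
    rw [hN, hN, hD, hD]
    have he : p ^ (2 * j * (k + 1) + (k + 1) * (k + 1 + 1)) =
        p ^ (2 * (j + 1) * k + k * (k + 1)) * (p ^ (j + 1)) ^ 2 := by
      rw [← pow_mul, ← pow_add]; congr 1; ring
    rw [he]
    linear_combination (p ^ (2 * (j + 1) * k + k * (k + 1)) * qPoch (b * u) p k *
      qPoch (u / b) p k * qPoch (b * p) p j * qPoch (p / b) p j) * hstep

/-- The summand, over an arbitrary field. -/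
noncomputable def qSummand {F : Type*} [Field F] (q a : F) (d : ℕ) (t : ℤ) (k : ℕ) : F :=
  qInt (q ^ 2) (2 * (d : ℤ) * k + t) * qInt q (2 * (d : ℤ) * k + t) ^ 2 *
    (qPoch (q ^ (2 * t)) (q ^ (2 * (d : ℤ))) k ^ 2 *
      qPoch (a * q ^ (2 * t)) (q ^ (2 * (d : ℤ))) k *
      qPoch (q ^ (2 * t) / a) (q ^ (2 * (d : ℤ))) k) /
    (qPoch (q ^ (2 * (d : ℤ))) (q ^ (2 * (d : ℤ))) k ^ 2 *
      qPoch (a * q ^ (2 * (d : ℤ))) (q ^ (2 * (d : ℤ))) k *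
      qPoch (q ^ (2 * (d : ℤ)) / a) (q ^ (2 * (d : ℤ))) k) *
    q ^ (-4 * t * k)

lemma qPoch_ne_zero_of_forall {L : Type*} [Field L] {x p : L} {k : ℕ}
    (h : ∀ i < k, x * p ^ i ≠ 1) : qPoch x p k ≠ 0 :=
  Finset.prod_ne_zero_iff.2 fun i hi => sub_ne_zero.2 (h i (Finset.mem_range.1 hi)).symm

lemma IsPrimitiveRoot.qPoch_ne_zero {L : Type*} [Field L] {p : L} {m : ℕ}
    (hp : IsPrimitiveRoot p m) {k : ℕ} (hk : k < m) : qPoch p p k ≠ 0 :=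
  qPoch_ne_zero_of_forall fun i hi => by
    rw [← pow_succ']
    exact hp.pow_ne_one_of_pos_of_lt (by omega) (by omega)

lemma qPoch_mul_ne_zero {L : Type*} [Field L] {p b : L} {m : ℕ}
    (hp : p ^ m = 1) (hb : b ^ m ≠ 1) (k : ℕ) : qPoch (b * p) p k ≠ 0 :=
  qPoch_ne_zero_of_forall fun i _ h => hb <| by
    have := congrArg (· ^ m) h
    simpa [mul_pow, hp, pow_right_comm p i m] using this

lemma qPoch_div_ne_zero {L : Type*} [Field L] {p b : L} {m : ℕ}
    (hp : p ^ m = 1) (hb : b ^ m ≠ 1) (k : ℕ) : qPoch (p / b) p k ≠ 0 := by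
  rw [div_eq_inv_mul]
  exact qPoch_mul_ne_zero hp (by simpa using hb) k

section RootOfUnity

variable {L : Type*} [Field L] {q b : L} {m d : ℕ}

lemma isPrimitiveRoot_zpow_two_mul (hq : IsPrimitiveRoot (q ^ 2) m) (hdm : Nat.Coprime d m) :
    IsPrimitiveRoot (q ^ (2 * (d : ℤ))) m := by
  have : q ^ (2 * (d : ℤ)) = (q ^ 2) ^ d := by
    rw [zpow_mul]; norm_cast
  rw [this]
  exact hq.pow_of_coprime d hdm

lemma qSummand_reflect (hq0 : q ≠ 0) (hq : IsPrimitiveRoot (q ^ 2) m)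
    (hdm : Nat.Coprime d m) (hb0 : b ≠ 0) (hb : b ^ m ≠ 1) (t : ℤ)
    {r : ℕ} (hr : r < m) (hrt : (q ^ (2 * (d : ℤ))) ^ r * q ^ (2 * t) = 1)
    {k j : ℕ} (hkj : k + j = r) :
    qSummand q b d t j = -qSummand q b d t k := by
  have hp := isPrimitiveRoot_zpow_two_mul hq hdm
  have hz (i : ℕ) : q ^ (2 * (d : ℤ) * i + t) = (q ^ (2 * (d : ℤ))) ^ i * q ^ t := by
    rw [zpow_add₀ hq0, zpow_mul, zpow_natCast]
  have hz2 (i : ℕ) : (q ^ 2) ^ (2 * (d : ℤ) * i + t) = (q ^ (2 * (d : ℤ) * i + t)) ^ 2 := by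
    rw [← zpow_natCast q 2, ← zpow_mul, mul_comm, zpow_mul]; norm_cast
  have hu (i : ℕ) : q ^ (-4 * t * i) = ((q ^ (2 * (d : ℤ))) ^ r) ^ (2 * i) := by
    rw [eq_inv_of_mul_eq_one_left hrt, ← zpow_neg, ← zpow_natCast, ← zpow_mul]
    congr 1; push_cast; ring
  have hut : q ^ (2 * t) = (q ^ t) ^ 2 := by
    rw [mul_comm, zpow_mul]; norm_cast
  have ha := pow_mul_qPoch_mul_qPoch_reflect hb0 r hrt
  have h1 := pow_mul_qPoch_mul_qPoch_reflect one_ne_zero r hrt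
  simp only [one_mul, div_one] at h1
  have hDb (i : ℕ) := qPoch_mul_ne_zero hp.pow_eq_one hb i
  have hDb' (i : ℕ) := qPoch_div_ne_zero hp.pow_eq_one hb i
  have hD1 (i : ℕ) (hi : i < m) := hp.qPoch_ne_zero hi
  have hp0 : q ^ (2 * (d : ℤ)) ≠ 0 := zpow_ne_zero _ hq0
  have hs0 : q ^ t ≠ 0 := zpow_ne_zero _ hq0
  have key (k j : ℕ) (hkj : k + j = r) : qSummand q b d t k =
      ((1 - (q ^ (2 * (d : ℤ) * k + t)) ^ 2) * (1 - q ^ (2 * (d : ℤ) * k + t)) ^ 2 /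
        ((q ^ (2 * (d : ℤ))) ^ k) ^ 2) *
      (qPoch (q ^ (2 * (d : ℤ))) (q ^ (2 * (d : ℤ))) r ^ 2 *
        (qPoch (b * q ^ (2 * (d : ℤ))) (q ^ (2 * (d : ℤ))) r *
        qPoch (q ^ (2 * (d : ℤ)) / b) (q ^ (2 * (d : ℤ))) r) / ((1 - q ^ 2) * (1 - q) ^ 2 *
        (q ^ (2 * (d : ℤ))) ^ (2 * k * j))) /
      ((qPoch (q ^ (2 * (d : ℤ))) (q ^ (2 * (d : ℤ))) k ^ 2 *
        (qPoch (b * q ^ (2 * (d : ℤ))) (q ^ (2 * (d : ℤ))) k *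
        qPoch (q ^ (2 * (d : ℤ)) / b) (q ^ (2 * (d : ℤ))) k)) *
       (qPoch (q ^ (2 * (d : ℤ))) (q ^ (2 * (d : ℤ))) j ^ 2 *
        (qPoch (b * q ^ (2 * (d : ℤ))) (q ^ (2 * (d : ℤ))) j *
        qPoch (q ^ (2 * (d : ℤ)) / b) (q ^ (2 * (d : ℤ))) j))) := by
    have e1 := h1 k j hkj
    have e2 := ha k j hkj
    have := hDb k
    have := hDb j
    have := hDb' k
    have := hDb' j
    have := hD1 k (by omega)
    have := hD1 j (by omega)
    rw [qSummand, qInt, qInt, hz2, hu, ← e2, pow_two (qPoch _ _ r), ← e1, ← hkj]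
    generalize q ^ (2 * (d : ℤ)) = p at *
    generalize q ^ (2 * (d : ℤ) * k + t) = z at *
    have hpow : (p ^ (k + j)) ^ (2 * k) * ((p ^ k) ^ 2 * p ^ (2 * k * j)) =
        (p ^ (2 * j * k + k * (k + 1))) ^ 2 := by
      simp only [← pow_mul, ← pow_add]; congr 1; ring
    have hX : (p ^ (k + j)) ^ (2 * k) =
        (p ^ (2 * j * k + k * (k + 1))) ^ 2 / ((p ^ k) ^ 2 * p ^ (2 * k * j)) := by
      rw [eq_div_iff (by positivity), hpow]
    rw [hX]
    generalize p ^ (2 * j * k + k * (k + 1)) = A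
    generalize (1 - q ^ 2) = c
    generalize (1 - q) = c'
    field_simp
  have hzz : (1 - (q ^ (2 * (d : ℤ) * j + t)) ^ 2) * (1 - q ^ (2 * (d : ℤ) * j + t)) ^ 2 /
        ((q ^ (2 * (d : ℤ))) ^ j) ^ 2 =
      -((1 - (q ^ (2 * (d : ℤ) * k + t)) ^ 2) * (1 - q ^ (2 * (d : ℤ) * k + t)) ^ 2 /
        ((q ^ (2 * (d : ℤ))) ^ k) ^ 2) := by
    rw [hz, hz]
    rw [hut, ← hkj, pow_add] at hrt
    generalize q ^ (2 * (d : ℤ)) = p at *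
    generalize q ^ t = s at *
    have hj : p ^ j * s = (p ^ k * s)⁻¹ := eq_inv_of_mul_eq_one_left (by linear_combination hrt)
    have hj' : p ^ j = (p ^ k * s ^ 2)⁻¹ := eq_inv_of_mul_eq_one_left (by linear_combination hrt)
    rw [hj, hj']
    field_simp
    ring
  rw [key k j hkj, key j k (by omega), hzz]
  ring

/-- The truncated sum vanishes when `q ^ 2` is a primitive `m`-th root of unity. -/
lemma sum_qSummand_eq_zero [CharZero L] (hm : m ≠ 0) (hq0 : q ≠ 0)
    (hq : IsPrimitiveRoot (q ^ 2) m)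
    (hdm : Nat.Coprime d m) (hb0 : b ≠ 0) (hb : b ^ m ≠ 1) (t : ℤ) :
    ∑ k ∈ Finset.range m, qSummand q b d t k = 0 := by
  have hp := isPrimitiveRoot_zpow_two_mul hq hdm
  have : NeZero m := ⟨hm⟩
  obtain ⟨r, hr, hrt⟩ := hp.eq_pow_of_pow_eq_one (ξ := (q ^ (2 * t))⁻¹) (by
    have : q ^ (2 * t) = (q ^ 2) ^ t := by rw [zpow_mul]; norm_cast
    rw [this, inv_pow, ← zpow_natCast, ← zpow_mul, mul_comm, zpow_mul, zpow_natCast,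
      hq.pow_eq_one, one_zpow, inv_one])
  have hrt' : (q ^ (2 * (d : ℤ))) ^ r * q ^ (2 * t) = 1 := by
    rw [hrt, inv_mul_cancel₀ (zpow_ne_zero _ hq0)]
  have htrunc : ∑ k ∈ Finset.range (r + 1), qSummand q b d t k =
      ∑ k ∈ Finset.range m, qSummand q b d t k := by
    refine Finset.sum_subset (Finset.range_subset_range.2 hr) fun k _ hk => ?_
    have : qPoch (q ^ (2 * t)) (q ^ (2 * (d : ℤ))) k = 0 :=
      Finset.prod_eq_zero (i := r) (by simp at hk ⊢; omega) (by rw [mul_comm, hrt', sub_self])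
    simp [qSummand, this]
  rw [← htrunc]
  have hrefl := Finset.sum_range_reflect (qSummand q b d t) (r + 1)
  rw [← self_eq_neg, ← Finset.sum_neg_distrib]
  nth_rewrite 1 [← hrefl]
  refine Finset.sum_congr rfl fun k hk => ?_
  rw [Finset.mem_range] at hk
  exact qSummand_reflect hq0 hq hdm hb0 hb t hr hrt' (by omega)

end RootOfUnity

section Specialization

variable {F L : Type*} [Field F] [Field L] [Algebra F L]

/-- The rational function `x` is regular at `α`, with value `y` there. -/
def HasValueAt (α : L) (x : RatFunc F) (y : L) : Prop :=
  ∃ f g : F[X], aeval α g ≠ 0 ∧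
    x * algebraMap F[X] (RatFunc F) g = algebraMap F[X] (RatFunc F) f ∧
    y * aeval α g = aeval α f

namespace HasValueAt

variable {α : L} {x x' : RatFunc F} {y y' : L}

lemma algebraMap_poly (α : L) (f : F[X]) :
    HasValueAt α (algebraMap F[X] (RatFunc F) f) (aeval α f) :=
  ⟨f, 1, by simp, by simp, by simp⟩

lemma one (α : L) : HasValueAt α (1 : RatFunc F) 1 := by
  simpa using algebraMap_poly α (1 : F[X])

lemma X (α : L) : HasValueAt α (RatFunc.X : RatFunc F) α := by
  simpa using algebraMap_poly α (Polynomial.X : F[X])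

lemma C (α : L) (c : F) : HasValueAt α (RatFunc.C c) (algebraMap F L c) := by
  simpa using algebraMap_poly α (Polynomial.C c)

lemma add (h : HasValueAt α x y) (h' : HasValueAt α x' y') :
    HasValueAt α (x + x') (y + y') := by
  obtain ⟨f, g, hg, e, v⟩ := h
  obtain ⟨f', g', hg', e', v'⟩ := h'
  refine ⟨f * g' + f' * g, g * g', by simp [hg, hg'], ?_, ?_⟩
  · simp only [map_add, map_mul, ← e, ← e']; ring
  · simp only [map_add, map_mul, ← v, ← v']; ring

lemma mul (h : HasValueAt α x y) (h' : HasValueAt α x' y') :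
    HasValueAt α (x * x') (y * y') := by
  obtain ⟨f, g, hg, e, v⟩ := h
  obtain ⟨f', g', hg', e', v'⟩ := h'
  refine ⟨f * f', g * g', by simp [hg, hg'], ?_, ?_⟩
  · simp only [map_mul, ← e, ← e']; ring
  · simp only [map_mul, ← v, ← v']; ring

lemma neg (h : HasValueAt α x y) : HasValueAt α (-x) (-y) := by
  obtain ⟨f, g, hg, e, v⟩ := h
  exact ⟨-f, g, hg, by simp [e], by simp [v]⟩

lemma sub (h : HasValueAt α x y) (h' : HasValueAt α x' y') :
    HasValueAt α (x - x') (y - y') := by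
  simpa only [sub_eq_add_neg] using h.add h'.neg

lemma inv (h : HasValueAt α x y) (hy : y ≠ 0) : HasValueAt α x⁻¹ y⁻¹ := by
  obtain ⟨f, g, hg, e, v⟩ := h
  have hf : aeval α f ≠ 0 := v ▸ mul_ne_zero hy hg
  have hx : x ≠ 0 := by
    rintro rfl
    have : f = 0 := by simpa using e.symm
    simp [this] at hf
  refine ⟨g, f, hf, ?_, ?_⟩
  · rw [← e, inv_mul_cancel_left₀ hx]
  · rw [← v, inv_mul_cancel_left₀ hy]

lemma div (h : HasValueAt α x y) (h' : HasValueAt α x' y') (hy : y' ≠ 0) :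
    HasValueAt α (x / x') (y / y') := by
  simpa only [div_eq_mul_inv] using h.mul (h'.inv hy)

lemma pow (h : HasValueAt α x y) (n : ℕ) : HasValueAt α (x ^ n) (y ^ n) := by
  induction n with
  | zero => simpa using one α
  | succ n ih => simpa only [pow_succ] using ih.mul h

lemma zpow (h : HasValueAt α x y) (hy : y ≠ 0) (n : ℤ) : HasValueAt α (x ^ n) (y ^ n) := by
  cases n with
  | ofNat n => simpa using h.pow n
  | negSucc n => simpa only [zpow_negSucc] using (h.pow (n + 1)).inv (pow_ne_zero _ hy)

lemma sum {ι : Type*} (s : Finset ι) {f : ι → RatFunc F} {g : ι → L}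
    (h : ∀ i ∈ s, HasValueAt α (f i) (g i)) : HasValueAt α (∑ i ∈ s, f i) (∑ i ∈ s, g i) := by
  classical
  induction s using Finset.induction_on with
  | empty => simpa using algebraMap_poly α (0 : F[X])
  | insert i s hi ih =>
    rw [Finset.sum_insert hi, Finset.sum_insert hi]
    exact (h i (by simp)).add (ih fun j hj => h j (by simp [hj]))

lemma qPoch (h : HasValueAt α x y) (h' : HasValueAt α x' y') (k : ℕ) :
    HasValueAt α (qPoch x x' k) (qPoch y y' k) := by
  induction k with
  | zero => simpa [_root_.qPoch] using one α
  | succ k ih =>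
    simp only [_root_.qPoch, Finset.prod_range_succ] at ih ⊢
    exact ih.mul ((one α).sub (h.mul (h'.pow k)))

lemma qInt (h : HasValueAt α x y) (hy : y ≠ 0) (hy1 : y ≠ 1) (n : ℤ) :
    HasValueAt α (qInt x n) (qInt y n) :=
  ((one α).sub (h.zpow hy n)).div ((one α).sub h) (sub_ne_zero.2 hy1.symm)

lemma qSummand {m d : ℕ} (h : HasValueAt α x y) (h' : HasValueAt α x' y') (hm : 1 < m)
    (hy0 : y ≠ 0) (hy : IsPrimitiveRoot (y ^ 2) m) (hdm : Nat.Coprime d m)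
    (hb0 : y' ≠ 0) (hb : y' ^ m ≠ 1) (t : ℤ) {k : ℕ} (hk : k < m) :
    HasValueAt α (qSummand x x' d t k) (qSummand y y' d t k) := by
  have hp := isPrimitiveRoot_zpow_two_mul hy hdm
  have hy2 : y ^ 2 ≠ 1 := hy.ne_one hm
  have hy1 : y ≠ 1 := by rintro rfl; simp at hy2
  have P := h.zpow hy0 (2 * (d : ℤ))
  have U := h.zpow hy0 (2 * t)
  refine .mul (.div (.mul (.mul ((h.pow 2).qInt (pow_ne_zero _ hy0) hy2 _)
    ((h.qInt hy0 hy1 _).pow 2)) (.mul (.mul ((U.qPoch P k).pow 2) ((h'.mul U).qPoch P k))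
      ((U.div h' hb0).qPoch P k)))
    (.mul (.mul ((P.qPoch P k).pow 2) ((h'.mul P).qPoch P k)) ((P.div h' hb0).qPoch P k)) ?_)
    (h.zpow hy0 _)
  exact mul_ne_zero (mul_ne_zero (pow_ne_zero _ (hp.qPoch_ne_zero hk))
    (qPoch_mul_ne_zero hp.pow_eq_one hb k)) (qPoch_div_ne_zero hp.pow_eq_one hb k)

lemma aeval_num (h : HasValueAt α x 0) : aeval α x.num = 0 := by
  obtain ⟨f, g, hg, e, v⟩ := h
  have hd : algebraMap F[X] (RatFunc F) x.denom ≠ 0 := by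
    simpa using x.denom_ne_zero
  have key : x.num * g = f * x.denom := by
    apply IsFractionRing.injective F[X] (RatFunc F)
    rw [map_mul, map_mul, ← e]
    nth_rewrite 2 [← RatFunc.num_div_denom x]
    field_simp
  have := congrArg (aeval α) key
  rw [map_mul, map_mul, ← v, zero_mul, zero_mul] at this
  exact (mul_eq_zero.1 this).resolve_right hg

end HasValueAt

lemma Polynomial.Separable.dvd_of_forall_aeval [IsAlgClosed L] {M f : F[X]} (hM : M.Separable)
    (h : ∀ α : L, aeval α M = 0 → aeval α f = 0) : M ∣ f := by
  by_cases hf : f = 0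
  · simp [hf]
  rw [← map_dvd_map' (algebraMap F L)]
  have hM0 : M.map (algebraMap F L) ≠ 0 :=
    (Polynomial.map_ne_zero_iff (algebraMap F L).injective).2 hM.ne_zero
  have hf0 : f.map (algebraMap F L) ≠ 0 :=
    (Polynomial.map_ne_zero_iff (algebraMap F L).injective).2 hf
  rw [(IsAlgClosed.splits _).dvd_iff_roots_le_roots hM0 hf0,
    Multiset.le_iff_subset (nodup_roots hM.map)]
  intro α hα
  rw [mem_roots hM0, IsRoot.def, eval_map_algebraMap] at hα
  rw [mem_roots hf0, IsRoot.def, eval_map_algebraMap]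
  exact h α hα

end Specialization

lemma ratCongr2_of_forall_hasValueAt_zero {L : Type*} [Field L] [Algebra (RatFunc ℚ) L]
    [IsAlgClosed L] {M : (RatFunc ℚ)[X]} (hM : M.Separable) {x : RatFunc (RatFunc ℚ)}
    (h : ∀ α : L, aeval α M = 0 → HasValueAt α x 0) : ratCongr2 M x := by
  obtain ⟨f, hf⟩ := hM.dvd_of_forall_aeval (f := x.num) fun α hα => (h α hα).aeval_num
  refine ⟨f, x.denom, (x.isCoprime_num_denom).of_isCoprime_of_dvd_left ⟨f, hf⟩, ?_⟩
  rw [← map_mul, ← hf]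
  have hd : algebraMap (RatFunc ℚ)[X] (RatFunc (RatFunc ℚ)) x.denom ≠ 0 := by
    simpa using x.denom_ne_zero
  nth_rewrite 1 [← RatFunc.num_div_denom x]
  exact div_mul_cancel₀ _ hd

lemma separable_cyclotomic_comp_X_sq {F : Type*} [Field F] [CharZero F] {m : ℕ} (hm : m ≠ 0) :
    ((cyclotomic m F).comp (X ^ 2)).Separable := by
  have hsep : (X ^ (2 * m) - 1 : F[X]).Separable :=
    separable_X_pow_sub_C 1 (by exact_mod_cast (by omega : 2 * m ≠ 0)) one_ne_zero
  obtain ⟨c, hc⟩ := cyclotomic.dvd_X_pow_sub_one m F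
  refine hsep.of_dvd ⟨c.comp (X ^ 2), ?_⟩
  rw [← mul_comp, ← hc]
  simp [pow_mul]

/-- Lemma 3 of the paper: the full parametric sum vanishes modulo `Φₘ(q²)`. -/
theorem stmt7 (m : ℕ) (hm : 1 < m) (d : ℕ) (hd : 2 ≤ d) (t : ℤ)
    (hdm : Nat.Coprime d m) (hdt : Int.gcd (d : ℤ) t = 1) :
    let q : RatFunc (RatFunc ℚ) := RatFunc.X
    let a : RatFunc (RatFunc ℚ) := RatFunc.C RatFunc.X
    ratCongr2 ((cyclotomic m (RatFunc ℚ)).comp (X ^ 2))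
      (∑ k ∈ Finset.range m,
        qInt (q ^ 2) (2 * (d : ℤ) * k + t) * qInt q (2 * (d : ℤ) * k + t) ^ 2 *
          (qPoch (q ^ (2 * t)) (q ^ (2 * (d : ℤ))) k ^ 2 *
            qPoch (a * q ^ (2 * t)) (q ^ (2 * (d : ℤ))) k *
            qPoch (q ^ (2 * t) / a) (q ^ (2 * (d : ℤ))) k) /
          (qPoch (q ^ (2 * (d : ℤ))) (q ^ (2 * (d : ℤ))) k ^ 2 *
            qPoch (a * q ^ (2 * (d : ℤ))) (q ^ (2 * (d : ℤ))) k *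
            qPoch (q ^ (2 * (d : ℤ)) / a) (q ^ (2 * (d : ℤ))) k) *
          q ^ (-4 * t * k)) := by
  intro q a
  have hm0 : m ≠ 0 := by omega
  refine ratCongr2_of_forall_hasValueAt_zero (L := AlgebraicClosure (RatFunc ℚ))
    (separable_cyclotomic_comp_X_sq hm0) fun α hα => ?_
  have : NeZero (m : AlgebraicClosure (RatFunc ℚ)) := ⟨by exact_mod_cast hm0⟩
  have hα2 : IsPrimitiveRoot (α ^ 2) m := by
    rw [← isRoot_cyclotomic_iff, IsRoot.def, ← map_cyclotomic m (algebraMap (RatFunc ℚ) _),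
      eval_map_algebraMap]
    simpa [aeval_comp] using hα
  have hα0 : α ≠ 0 := by
    rintro rfl
    exact hα2.ne_zero hm0 (by simp)
  set b : AlgebraicClosure (RatFunc ℚ) := algebraMap (RatFunc ℚ) _ RatFunc.X with hbdef
  have hb0 : b ≠ 0 := by simp [hbdef, RatFunc.X_ne_zero]
  have hb : b ^ m ≠ 1 := by
    rw [hbdef, ← map_pow, Ne, map_eq_one_iff _ (algebraMap (RatFunc ℚ) _).injective,
      ← RatFunc.algebraMap_X, ← map_pow,
      map_eq_one_iff _ (IsFractionRing.injective ℚ[X] (RatFunc ℚ))]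
    intro h
    have := congrArg natDegree h
    simp [hm0] at this
  rw [← sum_qSummand_eq_zero hm0 hα0 hα2 hdm hb0 hb t]
  exact HasValueAt.sum _ fun k hk =>
    (HasValueAt.X α).qSummand (HasValueAt.C α _) hm hα0 hα2 hdm hb0 hb t (Finset.mem_range.1 hk)
end

section
/- Let p be a prime with p ≡ 1 (mod 4). Then the sum over k from 0 to (p−1)/4 of (8k+1)^3 · ((1/4)_k / k!)^4 is congruent to −p · (1/2)_{(p−1)/4} / (1)_{(p−1)/4} modulo p^3. -/
open Polynomial Finset

/-- `x ≡ 0 (mod p^r)` for a rational number `x`: `x = p^r·(a/b)` with `b` prime to `p`,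
i.e. the `p`-adic valuation of `x` is at least `r` (or `x = 0`). -/
def padicCongr (p r : ℕ) (x : ℚ) : Prop :=
  ∃ a b : ℤ, ¬ (p : ℤ) ∣ b ∧ x * b = (p : ℚ) ^ r * a

section PadicCongr

variable {p : ℕ} {r s : ℕ} {x y : ℚ}

theorem padicCongr.add (hp : p.Prime) (hx : padicCongr p r x) (hy : padicCongr p r y) :
    padicCongr p r (x + y) := by
  obtain ⟨a, b, hb, hab⟩ := hx
  obtain ⟨c, d, hd, hcd⟩ := hy
  refine ⟨a * d + c * b, b * d, (Nat.prime_iff_prime_int.mp hp).not_dvd_mul hb hd, ?_⟩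
  push_cast
  linear_combination (d : ℚ) * hab + (b : ℚ) * hcd

theorem padicCongr.mul (hp : p.Prime) (hx : padicCongr p r x) (hy : padicCongr p s y) :
    padicCongr p (r + s) (x * y) := by
  obtain ⟨a, b, hb, hab⟩ := hx
  obtain ⟨c, d, hd, hcd⟩ := hy
  refine ⟨a * c, b * d, (Nat.prime_iff_prime_int.mp hp).not_dvd_mul hb hd, ?_⟩
  push_cast
  rw [pow_add]
  linear_combination (y * d : ℚ) * hab + ((p : ℚ) ^ r * a) * hcd

theorem padicCongr_int (hp : p.Prime) (m : ℤ) : padicCongr p 0 m :=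
  ⟨m, 1, (Nat.prime_iff_prime_int.mp hp).not_dvd_one, by simp⟩

theorem padicCongr_pow_self (hp : p.Prime) (r : ℕ) : padicCongr p r ((p : ℚ) ^ r) :=
  ⟨1, 1, (Nat.prime_iff_prime_int.mp hp).not_dvd_one, by simp⟩

theorem padicCongr_self (hp : p.Prime) : padicCongr p 1 (p : ℚ) := by
  simpa using padicCongr_pow_self hp 1

theorem padicCongr_zero (hp : p.Prime) (r : ℕ) : padicCongr p r 0 :=
  ⟨0, 1, (Nat.prime_iff_prime_int.mp hp).not_dvd_one, by simp⟩

theorem padicCongr_inv {m : ℤ} (hm : ¬ (p : ℤ) ∣ m) : padicCongr p 0 ((m : ℚ)⁻¹) := by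
  refine ⟨1, m, hm, ?_⟩
  have : (m : ℚ) ≠ 0 := by
    rintro h
    exact hm (by simp [Int.cast_eq_zero.mp h])
  simp [this]

theorem padicCongr.mul_left (hp : p.Prime) (hx : padicCongr p 0 x) (hy : padicCongr p r y) :
    padicCongr p r (x * y) := by
  simpa using hx.mul hp hy

theorem padicCongr.mul_right (hp : p.Prime) (hx : padicCongr p r x) (hy : padicCongr p 0 y) :
    padicCongr p r (x * y) :=
  hx.mul hp hy

theorem padicCongr.neg (hx : padicCongr p r x) : padicCongr p r (-x) := by
  obtain ⟨a, b, hb, hab⟩ := hx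
  exact ⟨-a, b, hb, by push_cast; linear_combination -hab⟩

theorem padicCongr.sub (hp : p.Prime) (hx : padicCongr p r x) (hy : padicCongr p r y) :
    padicCongr p r (x - y) := by
  simpa [sub_eq_add_neg] using hx.add hp hy.neg

theorem padicCongr.pow (hp : p.Prime) (hx : padicCongr p 0 x) (m : ℕ) :
    padicCongr p 0 (x ^ m) := by
  induction m with
  | zero => simpa using padicCongr_int hp 1
  | succ m ih => simpa [pow_succ] using ih.mul hp hx

theorem padicCongr.of_le (h : s ≤ r) (hx : padicCongr p r x) : padicCongr p s x := by
  obtain ⟨a, b, hb, hab⟩ := hx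
  refine ⟨(p : ℤ) ^ (r - s) * a, b, hb, ?_⟩
  push_cast
  rw [hab, ← mul_assoc, ← pow_add, Nat.add_sub_cancel' h]

theorem padicCongr_sum (hp : p.Prime) {ι : Type*} (S : Finset ι) (f : ι → ℚ)
    (h : ∀ i ∈ S, padicCongr p r (f i)) : padicCongr p r (∑ i ∈ S, f i) := by
  classical
  induction S using Finset.induction_on with
  | empty => simpa using padicCongr_zero hp r
  | insert i S hi ih =>
    rw [Finset.sum_insert hi]
    exact (h i (Finset.mem_insert_self i S)).add hp
      (ih fun j hj => h j (Finset.mem_insert_of_mem hj))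

/-- Products of congruent factors are congruent, provided `y` and `x'` are `p`-integral. -/
theorem padicCongr.mul_sub_mul (hp : p.Prime) {x' y' : ℚ} (hx : padicCongr p r (x - x'))
    (hy : padicCongr p r (y - y')) (hy0 : padicCongr p 0 y) (hx0 : padicCongr p 0 x') :
    padicCongr p r (x * y - x' * y') := by
  have := (hx.mul_right hp hy0).add hp (hx0.mul_left hp hy)
  convert this using 1
  ring

end PadicCongr

section Hypergeometric

/-- The ratio `(a)_k / k!`. -/
noncomputable def pochRatio (a : ℚ) (k : ℕ) : ℚ := (ascPochhammer ℚ k).eval a / (k.factorial : ℚ)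

theorem pochRatio_zero (a : ℚ) : pochRatio a 0 = 1 := by simp [pochRatio]

theorem pochRatio_succ (a : ℚ) (k : ℕ) :
    pochRatio a (k + 1) = pochRatio a k * ((a + k) / (k + 1)) := by
  have : ((k : ℚ) + 1) ≠ 0 := by positivity
  have : (k.factorial : ℚ) ≠ 0 := by positivity
  rw [pochRatio, pochRatio, ascPochhammer_succ_eval, Nat.factorial_succ]
  push_cast
  field_simp

theorem ascPochhammer_eval_shift (y : ℚ) (k : ℕ) :
    y * (ascPochhammer ℚ k).eval (y + 1) = (y + k) * (ascPochhammer ℚ k).eval y := by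
  induction k with
  | zero => simp
  | succ k ih =>
    rw [ascPochhammer_succ_eval, ascPochhammer_succ_eval]
    push_cast
    linear_combination (y + 1 + k) * ih

theorem ascPochhammer_eval_ne_zero {y : ℚ} (k : ℕ) (h : ∀ j : ℕ, y + j ≠ 0) :
    (ascPochhammer ℚ k).eval y ≠ 0 := by
  induction k with
  | zero => simp
  | succ k ih =>
    rw [ascPochhammer_succ_eval]
    exact mul_ne_zero ih (h k)

theorem ascPochhammer_eval_neg_eq_zero (n : ℕ) :
    (ascPochhammer ℚ (n + 1)).eval (-(n : ℚ)) = 0 := by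
  simp [ascPochhammer_succ_eval]

/-- The quotient `(-n)_k (2a+n)_k / ((1+a+n)_k (1-a-n)_k)`. -/
noncomputable def wellPoisedRatio (a : ℚ) (n k : ℕ) : ℚ :=
  (ascPochhammer ℚ k).eval (-(n : ℚ)) * (ascPochhammer ℚ k).eval (2 * a + n) /
    ((ascPochhammer ℚ k).eval (1 + a + n) * (ascPochhammer ℚ k).eval (1 - a - n))

theorem wellPoisedRatio_zero (a : ℚ) (n : ℕ) : wellPoisedRatio a n 0 = 1 := by
  simp [wellPoisedRatio]

theorem wellPoisedRatio_succ (a : ℚ) (n k : ℕ) :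
    wellPoisedRatio a n (k + 1) = wellPoisedRatio a n k *
      ((-(n : ℚ) + k) * (2 * a + n + k) / ((1 + a + n + k) * (1 - a - n + k))) := by
  simp only [wellPoisedRatio, ascPochhammer_succ_eval]
  rw [div_mul_div_comm]
  congr 1 <;> ring

/-- A Wilf–Zeilberger certificate for the well-poised sum of `vwp_sum`. -/
theorem vwp_partial_sum {a : ℚ} (ha : ∀ m : ℤ, a + m ≠ 0) (ha2 : ∀ m : ℕ, 2 * a + m ≠ 0)
    (n m : ℕ) :
    ∑ k ∈ range m, ((a + 2 * k) * pochRatio a k ^ 2 *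
        ((n + 1) * (a + n) * wellPoisedRatio a (n + 1) k -
          (a + n + 1) * (2 * a + n) * wellPoisedRatio a n k)) =
      (a + n + 1) * (1 + 2 * a + 2 * n) / ((2 * a + n) * (n + 1)) * m ^ 2 * (m - a - n) *
        pochRatio a m ^ 2 *
        ((ascPochhammer ℚ m).eval (-(n : ℚ) - 1) * (ascPochhammer ℚ m).eval (2 * a + n) /
          ((ascPochhammer ℚ m).eval (1 + a + n) * (ascPochhammer ℚ m).eval (1 - a - n))) := by
  induction m with
  | zero => simp
  | succ k ih =>
    have h1 := ascPochhammer_eval_shift (-(n : ℚ) - 1) k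
    have h2 := ascPochhammer_eval_shift (2 * a + n) k
    have h3 := ascPochhammer_eval_shift (1 + a + n) k
    have h4 := ascPochhammer_eval_shift (-a - n) k
    have n1 : (n : ℚ) + 1 ≠ 0 := by positivity
    have k1 : (k : ℚ) + 1 ≠ 0 := by positivity
    have n2 : 2 * a + n ≠ 0 := ha2 n
    have n3 : 1 + a + (n : ℚ) ≠ 0 := fun h => ha (1 + n) (by push_cast; linarith)
    have n4 : a + (n : ℚ) ≠ 0 := fun h => ha n (by push_cast; linarith)
    have n5 : 1 + a + (n : ℚ) + k ≠ 0 := fun h => ha (1 + n + k) (by push_cast; linarith)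
    have n6 : 1 - a - (n : ℚ) + k ≠ 0 := fun h => ha (n - 1 - k) (by push_cast; linarith)
    have n7 : a + (n : ℚ) - k ≠ 0 := fun h => ha (n - k) (by push_cast; linarith)
    have D1 : (ascPochhammer ℚ k).eval (1 + a + n) ≠ 0 :=
      ascPochhammer_eval_ne_zero k fun j h => ha (1 + n + j) (by push_cast; linarith)
    have D2 : (ascPochhammer ℚ k).eval (1 - a - n) ≠ 0 :=
      ascPochhammer_eval_ne_zero k fun j h => ha (n - 1 - j) (by push_cast; linarith)
    rw [sum_range_succ, ih]
    simp only [wellPoisedRatio, pochRatio_succ, ascPochhammer_succ_eval]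
    push_cast
    rw [show (-((n : ℚ) + 1)) = -n - 1 by ring, show 2 * a + ((n : ℚ) + 1) = 2 * a + n + 1 by ring,
      show 1 + a + ((n : ℚ) + 1) = 1 + a + n + 1 by ring,
      show 1 - a - ((n : ℚ) + 1) = -a - n by ring]
    rw [show -(n : ℚ) - 1 + 1 = -n by ring] at h1
    rw [show -a - (n : ℚ) + 1 = 1 - a - n by ring] at h4
    generalize (ascPochhammer ℚ k).eval (-(n : ℚ) - 1) = W at *
    generalize (ascPochhammer ℚ k).eval (-(n : ℚ)) = W' at *
    generalize (ascPochhammer ℚ k).eval (2 * a + n + 1) = V' at *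
    generalize (ascPochhammer ℚ k).eval (2 * a + n) = V at *
    generalize (ascPochhammer ℚ k).eval (1 + a + n + 1) = E1 at *
    generalize (ascPochhammer ℚ k).eval (1 + a + n) = A1 at *
    generalize (ascPochhammer ℚ k).eval (-a - n) = E2 at *
    generalize (ascPochhammer ℚ k).eval (1 - a - n) = A2 at *
    have e1 : W' = (n + 1 - k) / (n + 1) * W := by field_simp; linear_combination -h1
    have e2 : V' = (2 * a + n + k) / (2 * a + n) * V := by field_simp; linear_combination h2
    have e3 : E1 = (1 + a + n + k) / (1 + a + n) * A1 := by field_simp; linear_combination h3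
    have e4 : E2 = (a + n) / (a + n - k) * A2 := by field_simp; linear_combination h4
    rw [e1, e2, e3, e4]
    generalize pochRatio a k = b
    field_simp
    ring

theorem vwp_sum {a : ℚ} (ha : ∀ m : ℤ, a + m ≠ 0) (ha2 : ∀ m : ℕ, 2 * a + m ≠ 0) (n : ℕ) :
    ∑ k ∈ range (n + 1), (a + 2 * k) * pochRatio a k ^ 2 * wellPoisedRatio a n k =
      (a + n) * pochRatio (2 * a) n := by
  induction n with
  | zero => simp [pochRatio_zero, wellPoisedRatio_zero]
  | succ n ih =>
    have h := vwp_partial_sum ha ha2 n (n + 2)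
    have z := ascPochhammer_eval_neg_eq_zero (n + 1)
    have z' : wellPoisedRatio a n (n + 1) = 0 := by
      simp [wellPoisedRatio, ascPochhammer_eval_neg_eq_zero]
    rw [show -((n + 1 : ℕ) : ℚ) = -n - 1 by push_cast; ring] at z
    have n1 : (n : ℚ) + 1 ≠ 0 := by positivity
    have n4 : a + (n : ℚ) ≠ 0 := fun h => ha n (by push_cast; linarith)
    simp only [z, zero_mul, zero_div, mul_zero, mul_sub, sum_sub_distrib] at h
    rw [sum_range_succ (fun k : ℕ => _ * ((a + n + 1) * _ * _)) (n + 1), z'] at h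
    have key : (n + 1) * (a + n) * ∑ k ∈ range (n + 2),
        (a + 2 * k) * pochRatio a k ^ 2 * wellPoisedRatio a (n + 1) k =
        (a + n + 1) * (2 * a + n) * ((a + n) * pochRatio (2 * a) n) := by
      rw [← ih, mul_sum, mul_sum]
      rw [mul_zero, mul_zero, add_zero, sub_eq_zero] at h
      convert h using 1 <;> exact sum_congr rfl fun k _ => by ring
    apply mul_left_cancel₀ (mul_ne_zero n1 n4)
    rw [key, pochRatio_succ]
    push_cast
    field_simp
    ring

theorem sum_cube_add_linear (m : ℕ) :
    ∑ k ∈ range m, ((8 * (k : ℚ) + 1) ^ 3 + (8 * k + 1)) * pochRatio (1 / 4) k ^ 4 =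
      512 * (m * pochRatio (1 / 4) m) ^ 4 := by
  induction m with
  | zero => simp
  | succ m ih =>
    have : (m : ℚ) + 1 ≠ 0 := by positivity
    rw [sum_range_succ, ih, pochRatio_succ]
    push_cast
    field_simp
    ring

end Hypergeometric

section Expansion

variable {p n : ℕ}

theorem not_dvd_of_pos_of_lt {m : ℤ} (h0 : 0 < m) (h1 : m < p) : ¬ (p : ℤ) ∣ m :=
  fun h => absurd (Int.le_of_dvd h0 h) (not_le.mpr h1)

theorem padicCongr_inv_nat {m : ℕ} (h0 : 0 < m) (h1 : m < p) : padicCongr p 0 ((m : ℚ)⁻¹) := by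
  simpa using padicCongr_inv (p := p) (m := m) (not_dvd_of_pos_of_lt (by omega) (by omega))

theorem padicCongr_pochRatio (hp : p.Prime) (hn : p = 4 * n + 1) (k : ℕ) (hk : k ≤ n) :
    padicCongr p 0 (pochRatio (1 / 4) k) := by
  induction k with
  | zero => simpa [pochRatio_zero] using padicCongr_int hp 1
  | succ k ih =>
    rw [pochRatio_succ, show ((1 / 4 + k) / (k + 1) : ℚ) =
      ((4 * k + 1 : ℤ) : ℚ) * ((4 * (k + 1) : ℕ) : ℚ)⁻¹ by push_cast; field_simp; ring]
    exact (ih (by omega)).mul_left hp ((padicCongr_int hp _).mul hp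
      (padicCongr_inv_nat (by omega) (by omega)))

theorem pochRatio_congr_choose (hp : p.Prime) (hn : p = 4 * n + 1) (k : ℕ) (hk : k ≤ n) :
    padicCongr p 1 (pochRatio (1 / 4) k - (-1) ^ k * (n.choose k : ℚ)) := by
  induction k with
  | zero => simpa [pochRatio_zero] using padicCongr_zero hp 1
  | succ k ih =>
    have hc : (n.choose (k + 1) : ℚ) * (k + 1) = n.choose k * (n - k) := by
      have := Nat.choose_succ_right_eq n k
      rw [← Nat.cast_sub (by omega : k ≤ n)]
      exact_mod_cast this
    have h1 : (k : ℚ) + 1 ≠ 0 := by positivity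
    have hc' : (n.choose (k + 1) : ℚ) = n.choose k * (n - k) / (k + 1) := by
      field_simp; exact hc
    have hpn : (p : ℚ) = 4 * n + 1 := by exact_mod_cast hn
    have i4 := padicCongr_inv_nat (p := p) (m := 4 * (k + 1)) (by omega) (by omega)
    have i1 := padicCongr_inv_nat (p := p) (m := k + 1) (by omega) (by omega)
    have := ((ih (by omega)).mul_right hp ((padicCongr_int hp (k - n)).mul hp i1)).add hp
      ((padicCongr_pochRatio hp hn k (by omega)).mul_left hp
        ((padicCongr_self hp).mul_right hp i4))
    convert this using 1
    rw [pochRatio_succ, hc', hpn]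
    push_cast
    field_simp
    ring

theorem pochRatio_pow_four_reflect (hp : p.Prime) (hn : p = 4 * n + 1) (k : ℕ) (hk : k ≤ n) :
    padicCongr p 1 (pochRatio (1 / 4) k ^ 4 - pochRatio (1 / 4) (n - k) ^ 4) := by
  have key : ∀ j ≤ n, padicCongr p 1 (pochRatio (1 / 4) j ^ 4 - (n.choose j : ℚ) ^ 4) := by
    intro j hj
    have hb := padicCongr_pochRatio hp hn j hj
    have hc : padicCongr p 0 ((-1) ^ j * (n.choose j : ℚ)) := by
      simpa using padicCongr_int hp ((-1) ^ j * (n.choose j : ℤ))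
    have h := pochRatio_congr_choose hp hn j hj
    have h2 := h.mul_sub_mul hp h hb hc
    have h4 := h2.mul_sub_mul hp h2 (hb.mul hp hb) (hc.mul hp hc)
    convert h4 using 1
    have : ((-1 : ℚ) ^ j) ^ 4 = 1 := by rw [← pow_mul, mul_comm, pow_mul]; norm_num
    linear_combination ((n.choose j : ℚ) ^ 4) * this
  have := (key k hk).sub hp (key (n - k) (by omega))
  rw [Nat.choose_symm hk] at this
  convert this using 1
  ring

/-- The logarithmic derivative at `X = 0` of `∏_{j<k} ((4j+1)² - X) / ((4j+4)² - X)`. -/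
def logDerivSum (k : ℕ) : ℚ :=
  ∑ j ∈ range k, (((4 * (j : ℚ) + 4) ^ 2)⁻¹ - ((4 * (j : ℚ) + 1) ^ 2)⁻¹)

theorem logDerivSum_succ (k : ℕ) : logDerivSum (k + 1) = logDerivSum k +
    (((4 * (k : ℚ) + 4) ^ 2)⁻¹ - ((4 * (k : ℚ) + 1) ^ 2)⁻¹) :=
  sum_range_succ _ k

theorem padicCongr_logDerivSum (hp : p.Prime) (hn : p = 4 * n + 1) (k : ℕ) (hk : k ≤ n) :
    padicCongr p 0 (logDerivSum k) := by
  refine padicCongr_sum hp _ _ fun j hj => ?_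
  rw [mem_range] at hj
  have h4 := (padicCongr_inv_nat (p := p) (m := 4 * j + 4) (by omega) (by omega)).pow hp 2
  have h1 := (padicCongr_inv_nat (p := p) (m := 4 * j + 1) (by omega) (by omega)).pow hp 2
  convert h4.sub hp h1 using 1
  push_cast
  rw [inv_pow, inv_pow]

theorem logDerivSum_reflect (hp : p.Prime) (hn : p = 4 * n + 1) (k : ℕ) (hk : k ≤ n) :
    padicCongr p 1 (logDerivSum k - logDerivSum (n - k)) := by
  set H : ℕ → ℚ := fun k => ∑ j ∈ range k, ((4 * (j : ℚ) + 4) ^ 2)⁻¹ with hH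
  have key : ∀ k ≤ n, padicCongr p 1 (logDerivSum k - (H k - H n + H (n - k))) := by
    intro k hk
    induction k with
    | zero => simpa [logDerivSum, hH] using padicCongr_zero hp 1
    | succ k ih =>
      obtain ⟨m, hm⟩ : ∃ m, n = k + 1 + m := ⟨n - (k + 1), by omega⟩
      have e1 : H (k + 1) = H k + ((4 * (k : ℚ) + 4) ^ 2)⁻¹ := by simp [hH, sum_range_succ]
      have e2 : H (n - k) = H (n - (k + 1)) + ((4 * (m : ℚ) + 4) ^ 2)⁻¹ := by
        rw [show n - k = m + 1 by omega, show n - (k + 1) = m by omega]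
        simp [hH, sum_range_succ]
      have i1 := (padicCongr_inv_nat (p := p) (m := 4 * k + 1) (by omega) (by omega)).pow hp 2
      have i2 := (padicCongr_inv_nat (p := p) (m := 4 * m + 4) (by omega) (by omega)).pow hp 2
      have hpn : (p : ℚ) = (4 * k + 1) + (4 * m + 4) := by
        have : p = (4 * k + 1) + (4 * m + 4) := by omega
        exact_mod_cast this
      have := (ih (by omega)).add hp ((padicCongr_self hp).mul_right hp
        ((padicCongr_int hp ((4 * k + 1) - (4 * m + 4))).mul hp (i1.mul hp i2)))
      convert this using 1
      rw [e1, e2, logDerivSum_succ, hpn]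
      have : 4 * (k : ℚ) + 1 ≠ 0 := by positivity
      have : 4 * (m : ℚ) + 4 ≠ 0 := by positivity
      push_cast
      field_simp
      ring
  have := (key k hk).sub hp (key (n - k) (by omega))
  rw [Nat.sub_sub_self hk] at this
  convert this using 1
  ring

theorem sum_logDerivSum_congr (hp : p.Prime) (hn : p = 4 * n + 1) :
    padicCongr p 1 (∑ k ∈ range (n + 1),
      (8 * (k : ℚ) + 1) * (pochRatio (1 / 4) k ^ 4 * logDerivSum k)) := by
  set f : ℕ → ℚ := fun k => (8 * (k : ℚ) + 1) * (pochRatio (1 / 4) k ^ 4 * logDerivSum k) with hf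
  have hr : ∀ k ∈ range (n + 1), padicCongr p 1 (f k + f (n - k)) := by
    intro k hk
    have hk : k ≤ n := by simpa [Nat.lt_succ_iff] using hk
    have h1 := (pochRatio_pow_four_reflect hp hn k hk).mul_sub_mul hp
      (logDerivSum_reflect hp hn k hk) (padicCongr_logDerivSum hp hn k hk)
      ((padicCongr_pochRatio hp hn (n - k) (by omega)).pow hp 4)
    have h2 : padicCongr p 0 (pochRatio (1 / 4) (n - k) ^ 4 * logDerivSum (n - k)) :=
      ((padicCongr_pochRatio hp hn (n - k) (by omega)).pow hp 4).mul hp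
        (padicCongr_logDerivSum hp hn (n - k) (by omega))
    have := ((padicCongr_int hp (8 * k + 1)).mul_left hp h1).add hp
      ((padicCongr_self hp).mul_right hp ((padicCongr_int hp 2).mul hp h2))
    convert this using 1
    have hpn : (p : ℚ) = 4 * n + 1 := by exact_mod_cast hn
    simp only [hf]
    rw [hpn, Nat.cast_sub hk]
    push_cast
    ring
  have hs := padicCongr_sum hp _ _ hr
  rw [sum_add_distrib] at hs
  have hrefl := sum_range_reflect f (n + 1)
  simp only [Nat.add_sub_cancel_right] at hrefl
  rw [hrefl] at hs
  have h2 := padicCongr_inv_nat (p := p) (m := 2) (by omega) (by have := hp.two_le; omega)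
  convert h2.mul_left hp hs using 1
  push_cast
  ring

theorem wellPoisedRatio_expansion (hp : p.Prime) (hn : p = 4 * n + 1) (k : ℕ) (hk : k ≤ n) :
    padicCongr p 4 (wellPoisedRatio (1 / 4) n k -
      pochRatio (1 / 4) k ^ 2 * (1 + (p : ℚ) ^ 2 * logDerivSum k)) := by
  induction k with
  | zero => simpa [wellPoisedRatio_zero, pochRatio_zero, logDerivSum] using padicCongr_zero hp 4
  | succ k ih =>
    have hpn : (p : ℚ) = 4 * n + 1 := by exact_mod_cast hn
    have hnd : ¬ (p : ℤ) ∣ (4 * k + 4) ^ 2 - (p : ℤ) ^ 2 := by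
      intro h
      rw [dvd_sub_left (dvd_pow_self _ two_ne_zero)] at h
      exact not_dvd_of_pos_of_lt (by omega) (by omega)
        ((Nat.prime_iff_prime_int.mp hp).dvd_of_dvd_pow h)
    have hBP := padicCongr_inv hnd
    have hBP0 : (4 * (k : ℚ) + 4) ^ 2 - (p : ℚ) ^ 2 ≠ 0 := by
      have : ((4 * k + 4) ^ 2 - (p : ℤ) ^ 2 : ℤ) ≠ 0 := fun h => hnd (h ▸ dvd_zero _)
      exact_mod_cast this
    have hr : (-(n : ℚ) + k) * (2 * (1 / 4) + n + k) / ((1 + 1 / 4 + n + k) * (1 - 1 / 4 - n + k)) =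
        ((4 * k + 1) ^ 2 - (p : ℚ) ^ 2) * ((4 * (k : ℚ) + 4) ^ 2 - (p : ℚ) ^ 2)⁻¹ := by
      rw [← div_eq_mul_inv, ← mul_div_mul_left _ _ (show (16 : ℚ) ≠ 0 by norm_num), hpn]
      congr 1 <;> ring
    have hb := (padicCongr_pochRatio hp hn k (by omega)).pow hp 2
    have hL := padicCongr_logDerivSum hp hn k (by omega)
    have hB := (padicCongr_inv_nat (p := p) (m := 4 * k + 4) (by omega) (by omega)).pow hp 4
    have hA := padicCongr_int hp ((4 * k + 1) ^ 2 - (p : ℤ) ^ 2)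
    have hAB := (padicCongr_int hp ((4 * k + 1) ^ 2 - (4 * k + 4) ^ 2)).mul hp hB
    have hP := padicCongr_pow_self hp 4
    have h1 := (padicCongr_int hp 1).add hp
      (((padicCongr_pow_self hp 2).of_le (Nat.zero_le 2)).mul hp hL)
    have := ((ih (by omega)).mul_right hp (hA.mul hp hBP)).add hp
      (hP.mul_right hp (hb.mul hp (hAB.mul hp ((h1.mul hp hBP).add hp hL))))
    convert this using 1
    rw [wellPoisedRatio_succ, hr, pochRatio_succ, logDerivSum_succ]
    have : 4 * (k : ℚ) + 1 ≠ 0 := by positivity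
    have : 4 * (k : ℚ) + 4 ≠ 0 := by positivity
    have : (k : ℚ) + 1 ≠ 0 := by positivity
    push_cast
    rw [show (1 / 4 + (k : ℚ)) / (k + 1) = (4 * k + 1) / (4 * k + 4) by field_simp; ring]
    generalize 4 * (k : ℚ) + 1 = α at *
    generalize 4 * (k : ℚ) + 4 = β at *
    generalize (p : ℚ) = q at *
    field_simp
    ring

end Expansion

/-- The `q → 1` form of the second q-analogue of Van Hamme's (G.2):
`∑_{k=0}^{(p-1)/4} (8k+1)³ ((1/4)_k / k!)^4 ≡ -p (1/2)_{(p-1)/4} / (1)_{(p-1)/4} (mod p³)`. -/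
theorem stmt10 (p : ℕ) (hp : p.Prime) (hp4 : p % 4 = 1) :
    padicCongr p 3
      ((∑ k ∈ Finset.range ((p - 1) / 4 + 1),
          (8 * (k : ℚ) + 1) ^ 3 *
            ((ascPochhammer ℚ k).eval (1 / 4 : ℚ) / (k.factorial : ℚ)) ^ 4) -
        (-((p : ℚ) * (ascPochhammer ℚ ((p - 1) / 4)).eval (1 / 2 : ℚ) /
          (ascPochhammer ℚ ((p - 1) / 4)).eval (1 : ℚ)))) := by
  obtain ⟨n, hn⟩ : ∃ n, p = 4 * n + 1 := ⟨p / 4, by omega⟩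
  rw [show (p - 1) / 4 = n by omega]
  have hpn : (p : ℚ) = 4 * n + 1 := by exact_mod_cast hn
  have hterm : ∀ k ∈ range (n + 1), padicCongr p 3
      ((8 * (k : ℚ) + 1) * (pochRatio (1 / 4) k ^ 2 * (wellPoisedRatio (1 / 4) n k -
        pochRatio (1 / 4) k ^ 2 * (1 + (p : ℚ) ^ 2 * logDerivSum k)))) := by
    intro k hk
    have hk : k ≤ n := by simpa [Nat.lt_succ_iff] using hk
    have := (padicCongr_int hp (8 * k + 1)).mul_left hp
      (((padicCongr_pochRatio hp hn k hk).pow hp 2).mul_left hp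
        ((wellPoisedRatio_expansion hp hn k hk).of_le (show 3 ≤ 4 by norm_num)))
    exact_mod_cast this
  have hG : ∑ k ∈ range (n + 1), (8 * (k : ℚ) + 1) * pochRatio (1 / 4) k ^ 2 *
      wellPoisedRatio (1 / 4) n k = p * pochRatio (1 / 2) n := by
    have ha : ∀ m : ℤ, (1 / 4 : ℚ) + m ≠ 0 := by
      intro m h
      have : (1 + 4 * m : ℚ) = 0 := by linarith
      have : (1 + 4 * m : ℤ) = 0 := by exact_mod_cast this
      omega
    have h := vwp_sum ha (fun m => by positivity) n
    rw [show (2 * (1 / 4) : ℚ) = 1 / 2 by norm_num] at h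
    rw [hpn, show (4 * (n : ℚ) + 1) * pochRatio (1 / 2) n =
      4 * ((1 / 4 + n) * pochRatio (1 / 2) n) by ring, ← h, mul_sum]
    exact sum_congr rfl fun k _ => by ring
  have hcube := sum_cube_add_linear (n + 1)
  have hlast : ((n + 1 : ℕ) : ℚ) * pochRatio (1 / 4) (n + 1) = p / 4 * pochRatio (1 / 4) n := by
    have : (n : ℚ) + 1 ≠ 0 := by positivity
    rw [pochRatio_succ, hpn]
    push_cast
    field_simp
    ring
  rw [hlast] at hcube
  have hb := (padicCongr_pochRatio hp hn n le_rfl).pow hp 4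
  have h2p := ((padicCongr_int hp 2).mul_left hp
    ((padicCongr_pow_self hp 4).of_le (show 3 ≤ 4 by norm_num))).mul_right hp hb
  have hfinal := (h2p.add hp (padicCongr_sum hp _ _ hterm)).add hp
    ((padicCongr_pow_self hp 2).mul hp (sum_logDerivSum_congr hp hn))
  convert hfinal using 1
  rw [mul_div_assoc, ascPochhammer_eval_one]
  change (∑ k ∈ range (n + 1), (8 * (k : ℚ) + 1) ^ 3 * pochRatio (1 / 4) k ^ 4) -
    -(p * pochRatio (1 / 2) n) = _
  have hsplit : ∑ k ∈ range (n + 1), ((8 * (k : ℚ) + 1) * (pochRatio (1 / 4) k ^ 2 *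
      (wellPoisedRatio (1 / 4) n k -
        pochRatio (1 / 4) k ^ 2 * (1 + (p : ℚ) ^ 2 * logDerivSum k)))) =
      p * pochRatio (1 / 2) n - (∑ k ∈ range (n + 1), (8 * (k : ℚ) + 1) * pochRatio (1 / 4) k ^ 4) -
        (p : ℚ) ^ 2 * ∑ k ∈ range (n + 1),
          (8 * (k : ℚ) + 1) * (pochRatio (1 / 4) k ^ 4 * logDerivSum k) := by
    rw [← hG, mul_sum, ← sum_sub_distrib, ← sum_sub_distrib]
    exact sum_congr rfl fun k _ => by ring
  simp only [add_mul, sum_add_distrib] at hcube hsplit ⊢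
  rw [hsplit]
  push_cast
  linear_combination hcube
end

section
/- Let n > 1, d ≥ 2, t be integers with gcd(t,d) = 1, n ≡ t (mod d), and n + d − nd ≤ t ≤ n. Then the sum over k from 0 to (n−t)/d of [2dk+t] · (q^t;q^d)_k^4 / (q^d;q^d)_k^4 · q^{(d−2t)k} is congruent to ((q^{2t};q^d)_{(n−t)/d} / (q^d;q^d)_{(n−t)/d}) · [n] · q^{t(t−n)/d} modulo [n]·Φ_n(q)^2. -/
open Polynomial Finset

/-- The rational function `x ∈ ℚ(q)` is ≡ 0 modulo the polynomial `M`: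
its numerator in lowest terms is divisible by `M`, i.e. `x = M·f/g` with `g` coprime to `M`. -/
def ratCongr (M : Polynomial ℚ) (x : RatFunc ℚ) : Prop :=
  ∃ f g : Polynomial ℚ, IsCoprime M g ∧
    x * algebraMap (Polynomial ℚ) (RatFunc ℚ) g =
      algebraMap (Polynomial ℚ) (RatFunc ℚ) M * algebraMap (Polynomial ℚ) (RatFunc ℚ) f

theorem qPoch_zero {F : Type*} [Field F] (x r : F) : qPoch x r 0 = 1 := by
  simp [qPoch]

theorem qPoch_succ {F : Type*} [Field F] (x r : F) (k : ℕ) :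
    qPoch x r (k + 1) = qPoch x r k * (1 - x * r ^ k) :=
  Finset.prod_range_succ _ _

theorem qPoch_succ' {F : Type*} [Field F] (x r : F) (k : ℕ) :
    qPoch x r (k + 1) = (1 - x) * qPoch (x * r) r k := by
  rw [qPoch, Finset.prod_range_succ', mul_comm, qPoch]
  simp only [pow_zero, mul_one, pow_succ', mul_assoc]

theorem one_sub_mul_qPoch_shift {F : Type*} [Field F] (x r : F) (k : ℕ) :
    (1 - x) * qPoch (x * r) r k = qPoch x r k * (1 - x * r ^ k) := by
  rw [← qPoch_succ', qPoch_succ]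

theorem qPoch_ne_zero {F : Type*} [Field F] {x r : F} (h : ∀ k : ℕ, 1 - x * r ^ k ≠ 0) (k : ℕ) :
    qPoch x r k ≠ 0 :=
  Finset.prod_ne_zero_iff.mpr fun i _ => h i

/-- The `k`-th term of the terminating very-well-poised `₆φ₅` series with base `p`. -/
noncomputable def sixPhiFiveTerm {F : Type*} [Field F] (A B C p : F) (N k : ℕ) : F :=
  (1 - A * (p ^ k) ^ 2) *
    (qPoch A p k * qPoch B p k * qPoch C p k * qPoch (p ^ N)⁻¹ p k /
      (qPoch p p k * qPoch (A * p / B) p k * qPoch (A * p / C) p k *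
        qPoch (A * p ^ (N + 1)) p k)) * (A * p ^ (N + 1) / (B * C)) ^ k

/-- The Wilf–Zeilberger certificate for the recurrence in `N` of `sixPhiFiveTerm`. -/
noncomputable def sixPhiFiveCert {F : Type*} [Field F] (A B C p : F) (N k : ℕ) : F :=
  1 / (1 - 1 / p ^ (N + 1)) * ((1 - p ^ k) * (1 - A * p ^ k / B) * (1 - A * p ^ k / C) *
    (1 - A * p ^ (N + 1) * p ^ k)) / p ^ k *
    (qPoch A p k * qPoch B p k * qPoch C p k * qPoch (p ^ (N + 1))⁻¹ p k /
      (qPoch p p k * qPoch (A * p / B) p k * qPoch (A * p / C) p k *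
        qPoch (A * p ^ (N + 2)) p k)) * (A * p ^ (N + 2) / (B * C)) ^ k

theorem sixPhiFive_certificate_identity {F : Type*} [Field F] {A B C x y : F} (hB : B ≠ 0)
    (hC : C ≠ 0) (hy : y ≠ 0) (hx : x ≠ 0) (hy1 : y - 1 ≠ 0) :
    (1 - A * x ^ 2) * ((1 - A * y / B) * (1 - A * y / C) -
      (1 - x / y) * (1 - A * y * x) * ((1 - A * y / (B * C)) / (1 - 1 / y)) / x) =
    1 / (1 - 1 / y) * ((1 - A * x) * (1 - B * x) * (1 - C * x) * (1 - x / y) *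
      (A * y / (B * C)) / x -
      (1 - x) * (1 - A * x / B) * (1 - A * x / C) * (1 - A * y * x) / x) := by
  have h : 1 - 1 / y = (y - 1) / y := by field_simp
  rw [h]
  field_simp
  ring

theorem shifted_certificate_cancel {F : Type*} [Field F]
    {c1 c2 c3 c4 c5 c6 c7 c8 x p a b c e d1 d2 d3 d5 fa fb fc : F}
    (h2 : c2 ≠ 0) (h3 : c3 ≠ 0) (h4 : c4 ≠ 0) (h5 : c5 ≠ 0) (hp : p ≠ 0) :
    1 / c1 * (c2 * c3 * c4 * c5) / (x * p) *
      (a * fa * (b * fb) * (c * fc) * (e * c6) /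
        (d5 * c2 * (d1 * c3) * (d2 * c4) * (d3 * c5))) * (c7 * (c8 * p)) =
    1 / c1 * (fa * fb * fc * c6 * c8 / x) * (a * b * c * e / (d5 * d1 * d2 * d3) * c7) := by
  have h : a * fa * (b * fb) * (c * fc) * (e * c6) /
      (d5 * c2 * (d1 * c3) * (d2 * c4) * (d3 * c5)) =
      fa * fb * fc * c6 * (a * b * c * e / (d5 * d1 * d2 * d3)) / (c2 * c3 * c4 * c5) := by
    rw [mul_div_assoc', div_div]
    congr 1 <;> ring
  have hz : c2 * c3 * c4 * c5 ≠ 0 := by simp [*]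
  rw [h]
  generalize c2 * c3 * c4 * c5 = z at *
  generalize a * b * c * e / (d5 * d1 * d2 * d3) = W
  generalize fa * fb * fc * c6 = y
  calc _ = 1 / c1 * (y * c8 / x) * (W * c7) * (z / z) * (p / p) := by ring
    _ = _ := by rw [div_self hz, div_self hp, mul_one, mul_one]

theorem sixPhiFiveTerm_recurrence {F : Type*} [Field F] {A B C p : F} (hB : B ≠ 0) (hC : C ≠ 0)
    (hp : p ≠ 0) (h1 : ∀ k : ℕ, 1 - p * p ^ k ≠ 0) (hAB : ∀ k : ℕ, 1 - A * p / B * p ^ k ≠ 0)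
    (hAC : ∀ k : ℕ, 1 - A * p / C * p ^ k ≠ 0) (hA : ∀ k : ℕ, 1 - A * p ^ k ≠ 0) (N k : ℕ) :
    sixPhiFiveTerm A B C p (N + 1) k * ((1 - A * p ^ (N + 1) / B) * (1 - A * p ^ (N + 1) / C)) -
      sixPhiFiveTerm A B C p N k *
        ((1 - A * p ^ (N + 1)) * (1 - A * p ^ (N + 1) / (B * C))) =
    sixPhiFiveCert A B C p N (k + 1) - sixPhiFiveCert A B C p N k := by
  have hx : p ^ k ≠ 0 := pow_ne_zero _ hp
  have hy : p ^ (N + 1) ≠ 0 := pow_ne_zero _ hp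
  have hy1 : p ^ (N + 1) - 1 ≠ 0 := by
    intro h
    apply h1 N
    rw [← pow_succ', ← neg_sub, h, neg_zero]
  have hy2 : 1 - 1 / p ^ (N + 1) ≠ 0 := by
    rw [one_sub_div hy]
    exact div_ne_zero hy1 hy
  have e1 : qPoch (p ^ N)⁻¹ p k =
      qPoch (p ^ (N + 1))⁻¹ p k * (1 - p ^ k / p ^ (N + 1)) / (1 - 1 / p ^ (N + 1)) := by
    have := one_sub_mul_qPoch_shift (p ^ (N + 1))⁻¹ p k
    have h2 : (p ^ (N + 1))⁻¹ * p = (p ^ N)⁻¹ := by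
      rw [pow_succ]; field_simp
    rw [h2] at this
    rw [eq_div_iff hy2, one_div, mul_comm, this]
    ring
  have hz1 : 1 - A * p ^ (N + 1) ≠ 0 := hA _
  have hz2 : 1 - A * p ^ (N + 1) * p ^ k ≠ 0 := by
    rw [mul_assoc, ← pow_add]; exact hA _
  have hz3 : 1 - A * p ^ (N + 2) * p ^ k ≠ 0 := by
    rw [mul_assoc, ← pow_add]; exact hA _
  have e2 : qPoch (A * p ^ (N + 1)) p k =
      qPoch (A * p ^ (N + 2)) p k * (1 - A * p ^ (N + 1)) / (1 - A * p ^ (N + 1) * p ^ k) := by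
    have := one_sub_mul_qPoch_shift (A * p ^ (N + 1)) p k
    rw [mul_assoc, ← pow_succ] at this
    rw [eq_div_iff hz2, ← this, mul_comm]
  have e3 : (A * p ^ (N + 1) / (B * C)) ^ k = (A * p ^ (N + 2) / (B * C)) ^ k / p ^ k := by
    rw [← div_pow]
    congr 1
    rw [pow_succ _ (N + 1)]
    field_simp
  have n1 := qPoch_ne_zero h1 k
  have n2 := qPoch_ne_zero hAB k
  have n3 := qPoch_ne_zero hAC k
  have n4 : qPoch (A * p ^ (N + 2)) p k ≠ 0 := by
    apply qPoch_ne_zero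
    intro i
    rw [mul_assoc, ← pow_add]; exact hA _
  have key := sixPhiFive_certificate_identity (A := A) hB hC hy hx hy1
  set W := qPoch A p k * qPoch B p k * qPoch C p k * qPoch (p ^ (N + 1))⁻¹ p k /
      (qPoch p p k * qPoch (A * p / B) p k * qPoch (A * p / C) p k *
        qPoch (A * p ^ (N + 2)) p k) * (A * p ^ (N + 2) / (B * C)) ^ k with hW
  have t1 : sixPhiFiveTerm A B C p (N + 1) k = (1 - A * (p ^ k) ^ 2) * W := by
    rw [sixPhiFiveTerm, hW, mul_assoc]
  have t2 : sixPhiFiveTerm A B C p N k * ((1 - A * p ^ (N + 1)) * (1 - A * p ^ (N + 1) / (B * C)))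
      = (1 - A * (p ^ k) ^ 2) * ((1 - p ^ k / p ^ (N + 1)) * (1 - A * p ^ (N + 1) * p ^ k) *
        ((1 - A * p ^ (N + 1) / (B * C)) / (1 - 1 / p ^ (N + 1))) / p ^ k) * W := by
    rw [sixPhiFiveTerm, e1, e2, e3, hW]
    generalize 1 - 1 / p ^ (N + 1) = c1 at *
    generalize 1 - A * p ^ (N + 1) / (B * C) = c2 at *
    generalize (A * p ^ (N + 2) / (B * C)) ^ k = c3 at *
    generalize 1 - A * p ^ (N + 1) * p ^ k = c4 at *
    generalize 1 - A * p ^ (N + 1) = c5 at *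
    generalize 1 - p ^ k / p ^ (N + 1) = c6 at *
    field_simp
  have t3 : sixPhiFiveCert A B C p N k = 1 / (1 - 1 / p ^ (N + 1)) * ((1 - p ^ k) *
      (1 - A * p ^ k / B) * (1 - A * p ^ k / C) * (1 - A * p ^ (N + 1) * p ^ k) / p ^ k) * W := by
    rw [sixPhiFiveCert, hW]
    ring
  have t4 : sixPhiFiveCert A B C p N (k + 1) = 1 / (1 - 1 / p ^ (N + 1)) * ((1 - A * p ^ k) *
      (1 - B * p ^ k) * (1 - C * p ^ k) * (1 - p ^ k / p ^ (N + 1)) *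
      (A * p ^ (N + 1) / (B * C)) / p ^ k) * W := by
    have f1 := h1 k
    have f2 := hAB k
    have f3 := hAC k
    rw [sixPhiFiveCert, hW]
    simp only [qPoch_succ]
    rw [pow_succ (A * p ^ (N + 2) / (B * C)) k]
    have g1 : 1 - p ^ (k + 1) = 1 - p * p ^ k := by ring
    have g2 : 1 - A * p ^ (k + 1) / B = 1 - A * p / B * p ^ k := by ring
    have g3 : 1 - A * p ^ (k + 1) / C = 1 - A * p / C * p ^ k := by ring
    have g4 : 1 - A * p ^ (N + 1) * p ^ (k + 1) = 1 - A * p ^ (N + 2) * p ^ k := by ring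
    have g5 : 1 - (p ^ (N + 1))⁻¹ * p ^ k = 1 - p ^ k / p ^ (N + 1) := by ring
    have g6 : A * p ^ (N + 2) / (B * C) = A * p ^ (N + 1) / (B * C) * p := by ring
    rw [g1, g2, g3, g4, g5, g6, pow_succ p k]
    exact shifted_certificate_cancel f1 f2 f3 hz3 hp
  rw [t1, t2, t3, t4]
  linear_combination W * key

theorem sum_sixPhiFiveTerm {F : Type*} [Field F] {A B C p : F} (hB : B ≠ 0) (hC : C ≠ 0)
    (hp : p ≠ 0) (h1 : ∀ k : ℕ, 1 - p * p ^ k ≠ 0) (hAB : ∀ k : ℕ, 1 - A * p / B * p ^ k ≠ 0)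
    (hAC : ∀ k : ℕ, 1 - A * p / C * p ^ k ≠ 0) (hA : ∀ k : ℕ, 1 - A * p ^ k ≠ 0) (N : ℕ) :
    ∑ k ∈ range (N + 1), sixPhiFiveTerm A B C p N k =
      (1 - A) * (qPoch (A * p) p N * qPoch (A * p / (B * C)) p N) /
        (qPoch (A * p / B) p N * qPoch (A * p / C) p N) := by
  have last (M : ℕ) : qPoch (p ^ M)⁻¹ p (M + 1) = 0 := by
    rw [qPoch_succ, inv_mul_cancel₀ (pow_ne_zero _ hp), sub_self, mul_zero]
  induction N with
  | zero => simp [sixPhiFiveTerm, qPoch_zero]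
  | succ N ih =>
    have tel := Finset.sum_range_sub (sixPhiFiveCert A B C p N) (N + 2)
    rw [← Finset.sum_congr rfl
      fun k _ => sixPhiFiveTerm_recurrence hB hC hp h1 hAB hAC hA N k] at tel
    have c0 : sixPhiFiveCert A B C p N 0 = 0 := by simp [sixPhiFiveCert]
    have c1 : sixPhiFiveCert A B C p N (N + 2) = 0 := by
      rw [sixPhiFiveCert, last (N + 1)]; simp
    have l0 : sixPhiFiveTerm A B C p N (N + 1) = 0 := by
      rw [sixPhiFiveTerm, last N]; simp
    rw [c0, c1, sub_zero, Finset.sum_sub_distrib, ← Finset.sum_mul, ← Finset.sum_mul,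
      Finset.sum_range_succ (sixPhiFiveTerm A B C p N), l0, add_zero, ih] at tel
    have f2 := hAB N
    have f3 := hAC N
    have n2 := qPoch_ne_zero hAB N
    have n3 := qPoch_ne_zero hAC N
    simp only [qPoch_succ]
    have g2 : 1 - A * p ^ (N + 1) / B = 1 - A * p / B * p ^ N := by ring
    have g3 : 1 - A * p ^ (N + 1) / C = 1 - A * p / C * p ^ N := by ring
    have g4 : 1 - A * p ^ (N + 1) / (B * C) = 1 - A * p / (B * C) * p ^ N := by ring
    have g5 : 1 - A * p ^ (N + 1) = 1 - A * p * p ^ N := by ring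
    rw [g2, g3, g4, g5, sub_eq_zero, ← eq_div_iff (mul_ne_zero f2 f3)] at tel
    rw [tel]
    generalize 1 - A * p / B * p ^ N = c3 at *
    generalize 1 - A * p / C * p ^ N = c4 at *
    field_simp

theorem qPoch_zpow {F : Type*} [Field F] {q : F} (hq : q ≠ 0) (u : ℤ) (d k : ℕ) :
    qPoch (q ^ u) (q ^ (d : ℤ)) k = ∏ i ∈ range k, (1 - q ^ (u + d * i)) := by
  refine Finset.prod_congr rfl fun i _ => ?_
  rw [zpow_add₀ hq, zpow_mul, zpow_natCast (q ^ (d : ℤ))]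

theorem Valuation.map_sum_le_of_antisymm {F Γ₀ : Type*} [Field F]
    [LinearOrderedCommGroupWithZero Γ₀] (v : Valuation F Γ₀) (h2 : v 2 = 1) {γ : Γ₀}
    {s : Finset ℕ} {σ : ℕ → ℕ} (hσ : ∀ k ∈ s, σ k ∈ s) (hσσ : ∀ k ∈ s, σ (σ k) = k)
    {f : ℕ → F} (hf : ∀ k ∈ s, v (f k + f (σ k)) ≤ γ) : v (∑ k ∈ s, f k) ≤ γ := by
  have h : ∑ k ∈ s, f (σ k) = ∑ k ∈ s, f k :=
    Finset.sum_nbij' σ σ hσ hσ hσσ hσσ fun _ _ => rfl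
  have h' : 2 * ∑ k ∈ s, f k = ∑ k ∈ s, (f k + f (σ k)) := by
    rw [Finset.sum_add_distrib, h, two_mul]
  rw [← one_mul (v _), ← h2, ← map_mul, h']
  exact v.map_sum_le hf

theorem Valuation.map_mul_sub_mul_le {F Γ₀ : Type*} [Field F] [LinearOrderedCommGroupWithZero Γ₀]
    (v : Valuation F Γ₀) {γ : Γ₀} {x y x' y' : F} (hx' : v x' ≤ 1) (hy : v y ≤ 1)
    (hx : v (x - x') ≤ γ) (hyy : v (y - y') ≤ γ) : v (x * y - x' * y') ≤ γ := by
  have h : x * y - x' * y' = (x - x') * y + x' * (y - y') := by ring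
  rw [h]
  refine v.map_add_le ?_ ?_
  · rw [map_mul]; exact (mul_le_of_le_one_right' hy).trans hx
  · rw [map_mul]; exact (mul_le_of_le_one_left' hx').trans hyy

theorem Valuation.map_prod_sub_prod_le {F Γ₀ : Type*} [Field F]
    [LinearOrderedCommGroupWithZero Γ₀] (v : Valuation F Γ₀) {γ : Γ₀} {k : ℕ} {f g : ℕ → F}
    (hf : ∀ i < k, v (f i) ≤ 1) (hg : ∀ i < k, v (g i) ≤ 1)
    (hfg : ∀ i < k, v (f i - g i) ≤ γ) :
    v (∏ i ∈ range k, f i - ∏ i ∈ range k, g i) ≤ γ := by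
  induction k with
  | zero => simp
  | succ k ih =>
    rw [Finset.prod_range_succ, Finset.prod_range_succ]
    refine v.map_mul_sub_mul_le ?_ (hf k k.lt_succ_self) ?_ (hfg k k.lt_succ_self)
    · rw [map_prod]
      exact Finset.prod_le_one' fun i hi => hg i (by simp at hi; omega)
    · exact ih (fun i hi => hf i (by omega)) (fun i hi => hg i (by omega))
        fun i hi => hfg i (by omega)

theorem dvd_add_mul_iff_modEq {m d : ℕ} (hmd : m.Coprime d) {u : ℤ} {ρ : ℕ}
    (hρ : (m : ℤ) ∣ u + d * ρ) (j : ℕ) : (m : ℤ) ∣ u + d * j ↔ j ≡ ρ [MOD m] := by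
  rw [← Int.natCast_modEq_iff, Int.modEq_comm, Int.modEq_iff_dvd, ← dvd_sub_left hρ]
  have h : u + (d : ℤ) * j - (u + d * ρ) = d * (j - ρ) := by ring
  rw [h]
  exact ⟨fun hd => (Int.isCoprime_iff_gcd_eq_one.mpr (by simpa using hmd)).dvd_of_dvd_mul_left hd,
    fun hd => hd.mul_left _⟩

theorem not_dvd_mul_of_div_eq {m d k p : ℕ} (hm : 0 < m) (hmd : m.Coprime d)
    (hdiv : k / m = (k + p) / m) {i : ℕ} (hi : i < p) : ¬ (m : ℤ) ∣ d * (k + 1 + i) := by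
  intro h
  have h1 : (m : ℤ) ∣ ((k + 1 + i : ℕ) : ℤ) := by
    push_cast
    exact (Int.isCoprime_iff_gcd_eq_one.mpr (by simpa using hmd)).dvd_of_dvd_mul_left h
  obtain ⟨c, hc⟩ := Int.natCast_dvd_natCast.mp h1
  have h2 : c ≤ (k + p) / m := by
    rw [Nat.le_div_iff_mul_le hm, mul_comm]; omega
  have h3 : k / m < c := by
    rw [Nat.div_lt_iff_lt_mul hm, mul_comm]; omega
  omega

/-- A valuation on a field for which `q` reduces to a primitive `m`-th root of unity, and for
which every nontrivial multiple `s` of `m` gives the same valuation `ε` to `1 - q ^ s`. -/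
structure IsCyclotomicValuation {F Γ₀ : Type*} [Field F] [LinearOrderedCommGroupWithZero Γ₀]
    (v : Valuation F Γ₀) (q : F) (m : ℕ) (ε : Γ₀) : Prop where
  one_lt : 1 < m
  map_q : v q = 1
  map_two : v 2 = 1
  le_one : ε ≤ 1
  ne_zero : ε ≠ 0
  map_of_dvd : ∀ s : ℤ, s ≠ 0 → (m : ℤ) ∣ s → v (1 - q ^ s) = ε
  map_of_not_dvd : ∀ s : ℤ, ¬ (m : ℤ) ∣ s → v (1 - q ^ s) = 1

namespace IsCyclotomicValuation

variable {F Γ₀ : Type*} [Field F] [LinearOrderedCommGroupWithZero Γ₀]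
  {v : Valuation F Γ₀} {q : F} {m : ℕ} {ε : Γ₀}

theorem q_ne_zero (h : IsCyclotomicValuation v q m ε) : q ≠ 0 := by
  rintro rfl
  simpa using h.map_q

theorem map_zpow (h : IsCyclotomicValuation v q m ε) (s : ℤ) : v (q ^ s) = 1 := by
  rw [map_zpow₀, h.map_q, one_zpow]

theorem map_le_of_dvd (h : IsCyclotomicValuation v q m ε) {s : ℤ} (hs : (m : ℤ) ∣ s) :
    v (1 - q ^ s) ≤ ε := by
  rcases eq_or_ne s 0 with rfl | h0
  · simp
  · exact (h.map_of_dvd s h0 hs).le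

theorem map_le_one (h : IsCyclotomicValuation v q m ε) (s : ℤ) : v (1 - q ^ s) ≤ 1 := by
  by_cases hs : (m : ℤ) ∣ s
  · exact (h.map_le_of_dvd hs).trans h.le_one
  · exact (h.map_of_not_dvd s hs).le

theorem one_sub_ne_zero (h : IsCyclotomicValuation v q m ε) {s : ℤ} (hs : s ≠ 0) :
    1 - q ^ s ≠ 0 := by
  rw [← v.ne_zero_iff]
  by_cases hd : (m : ℤ) ∣ s
  · rw [h.map_of_dvd s hs hd]; exact h.ne_zero
  · rw [h.map_of_not_dvd s hd]; exact one_ne_zero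

theorem map_one_sub_q (h : IsCyclotomicValuation v q m ε) : v (1 - q) = 1 := by
  have := h.map_of_not_dvd 1 fun hd => by
    have := Int.le_of_dvd one_pos hd
    have := h.one_lt
    omega
  simpa using this

theorem map_qInt_le_one (h : IsCyclotomicValuation v q m ε) (s : ℤ) : v (qInt q s) ≤ 1 := by
  rw [qInt, map_div₀, h.map_one_sub_q, div_one]
  exact h.map_le_one s

theorem map_qPoch_le (h : IsCyclotomicValuation v q m ε) {d : ℕ} (hmd : m.Coprime d) {u : ℤ}
    {ρ : ℕ} (hρ : (m : ℤ) ∣ u + d * ρ) (k : ℕ) :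
    v (qPoch (q ^ u) (q ^ (d : ℤ)) k) ≤ ε ^ Nat.count (· ≡ ρ [MOD m]) k := by
  rw [qPoch_zpow h.q_ne_zero]
  induction k with
  | zero => simp
  | succ k ih =>
    rw [Finset.prod_range_succ, map_mul, Nat.count_succ, pow_add]
    refine mul_le_mul' ih ?_
    split_ifs with hk
    · rw [pow_one]
      exact h.map_le_of_dvd ((dvd_add_mul_iff_modEq hmd hρ k).mpr hk)
    · rw [pow_zero]
      exact h.map_le_one _

theorem map_qPoch_self (h : IsCyclotomicValuation v q m ε) {d : ℕ} (hd : d ≠ 0)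
    (hmd : m.Coprime d) (k : ℕ) :
    v (qPoch (q ^ (d : ℤ)) (q ^ (d : ℤ)) k) = ε ^ (k / m) := by
  have hm := h.one_lt
  have hρ : (m : ℤ) ∣ d + d * (m - 1 : ℕ) := by
    refine ⟨d, ?_⟩
    push_cast [hm.le]
    ring
  have hc : k / m = Nat.count (· ≡ m - 1 [MOD m]) k := by
    rw [Nat.count_modEq_card k (by omega), if_neg, add_zero]
    rw [Nat.mod_eq_of_lt (by omega : m - 1 < m)]
    have := Nat.mod_lt k (by omega : m > 0)
    omega
  rw [hc, qPoch_zpow h.q_ne_zero]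
  clear hc
  induction k with
  | zero => simp
  | succ k ih =>
    rw [Finset.prod_range_succ, map_mul, Nat.count_succ, pow_add, ih]
    congr 1
    split_ifs with hk
    · rw [pow_one]
      refine h.map_of_dvd _ ?_ ((dvd_add_mul_iff_modEq hmd hρ k).mpr hk)
      positivity
    · rw [pow_zero]
      exact h.map_of_not_dvd _ fun hk' => hk ((dvd_add_mul_iff_modEq hmd hρ k).mp hk')

theorem map_qPoch_div_le (h : IsCyclotomicValuation v q m ε) {d : ℕ} (hd : d ≠ 0)
    (hmd : m.Coprime d) {u : ℤ} {ρ : ℕ} (hρ : (m : ℤ) ∣ u + d * ρ) (k : ℕ) :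
    v (qPoch (q ^ u) (q ^ (d : ℤ)) k / qPoch (q ^ (d : ℤ)) (q ^ (d : ℤ)) k) ≤
      if ρ % m < k % m then ε else 1 := by
  have hm := h.one_lt
  rw [map_div₀, h.map_qPoch_self hd hmd]
  have hle := h.map_qPoch_le hmd hρ k
  rw [Nat.count_modEq_card k (by omega), pow_add] at hle
  have h0 : 0 < ε ^ (k / m) := pow_pos (zero_lt_iff.mpr h.ne_zero) _
  rw [div_le_iff₀ h0, mul_comm]
  split_ifs at hle ⊢ <;> simpa using hle

theorem map_qPoch_div_le_one (h : IsCyclotomicValuation v q m ε) {d : ℕ} (hd : d ≠ 0)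
    (hmd : m.Coprime d) {u : ℤ} {ρ : ℕ} (hρ : (m : ℤ) ∣ u + d * ρ) (k : ℕ) :
    v (qPoch (q ^ u) (q ^ (d : ℤ)) k / qPoch (q ^ (d : ℤ)) (q ^ (d : ℤ)) k) ≤ 1 := by
  refine (h.map_qPoch_div_le hd hmd hρ k).trans ?_
  split_ifs
  · exact h.le_one
  · exact le_rfl

end IsCyclotomicValuation

/-- The `k`-th summand `[2dk+t] (q^t;q^d)_k⁴ / (q^d;q^d)_k⁴ q^((d-2t)k)`. -/
noncomputable def quarticTerm {F : Type*} [Field F] (q : F) (d : ℕ) (t : ℤ) (k : ℕ) : F :=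
  qInt q (2 * (d : ℤ) * k + t) * qPoch (q ^ t) (q ^ (d : ℤ)) k ^ 4 /
    qPoch (q ^ (d : ℤ)) (q ^ (d : ℤ)) k ^ 4 * q ^ (((d : ℤ) - 2 * t) * k)

theorem quarticTerm_eq {F : Type*} [Field F] (q : F) (d : ℕ) (t : ℤ) (k : ℕ) :
    quarticTerm q d t k = qInt q (2 * (d : ℤ) * k + t) *
      (qPoch (q ^ t) (q ^ (d : ℤ)) k / qPoch (q ^ (d : ℤ)) (q ^ (d : ℤ)) k) ^ 4 *
        q ^ (((d : ℤ) - 2 * t) * k) := by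
  rw [quarticTerm, div_pow]
  ring

namespace IsCyclotomicValuation

variable {F Γ₀ : Type*} [Field F] [LinearOrderedCommGroupWithZero Γ₀]
  {v : Valuation F Γ₀} {q : F} {m : ℕ} {ε : Γ₀}

theorem map_quarticTerm_le (h : IsCyclotomicValuation v q m ε) {d : ℕ} (hd : d ≠ 0)
    (hmd : m.Coprime d) {t : ℤ} {ρ : ℕ} (hρ : (m : ℤ) ∣ t + d * ρ) (k : ℕ) :
    v (quarticTerm q d t k) ≤ if ρ % m < k % m then ε else 1 := by
  rw [quarticTerm_eq, map_mul, map_mul, map_pow, h.map_zpow, mul_one]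
  refine (mul_le_of_le_one_left' (h.map_qInt_le_one _)).trans ?_
  refine le_trans ?_ (h.map_qPoch_div_le hd hmd hρ k)
  exact pow_le_of_le_one zero_le (h.map_qPoch_div_le_one hd hmd hρ k) four_ne_zero

theorem map_quarticTerm_le_one (h : IsCyclotomicValuation v q m ε) {d : ℕ} (hd : d ≠ 0)
    (hmd : m.Coprime d) {t : ℤ} {ρ : ℕ} (hρ : (m : ℤ) ∣ t + d * ρ) (k : ℕ) :
    v (quarticTerm q d t k) ≤ 1 := by
  refine (h.map_quarticTerm_le hd hmd hρ k).trans ?_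
  split_ifs
  · exact h.le_one
  · exact le_rfl

/-- Replacing `q ^ (w - D)` by `q ^ (-D)` for `m ∣ w`. -/
theorem map_div_add_le (h : IsCyclotomicValuation v q m ε) {w D : ℤ} (hw : (m : ℤ) ∣ w)
    (hD : ¬ (m : ℤ) ∣ D) : v ((1 - q ^ (w - D)) / (1 - q ^ D) - -q ^ (-D)) ≤ ε := by
  have hq := h.q_ne_zero
  have h1 : 1 - q ^ D ≠ 0 := by
    rw [← v.ne_zero_iff, h.map_of_not_dvd D hD]; exact one_ne_zero
  have h2 : q ^ D ≠ 0 := zpow_ne_zero _ hq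
  have key : (1 - q ^ (w - D)) / (1 - q ^ D) - -q ^ (-D) =
      (1 - q ^ w) / (q ^ D * (1 - q ^ D)) := by
    rw [zpow_sub₀ hq, zpow_neg]
    field_simp
    ring
  rw [key, map_div₀, map_mul, h.map_zpow, h.map_of_not_dvd D hD, one_mul, div_one]
  exact h.map_le_of_dvd hw

theorem map_quarticTerm_add_le (h : IsCyclotomicValuation v q m ε) {d : ℕ} (hd : d ≠ 0)
    (hmd : m.Coprime d) {t : ℤ} {ρ : ℕ} (hρ : (m : ℤ) ∣ t + d * ρ) {k p : ℕ}
    (hw : (m : ℤ) ∣ t + d * (2 * k + p))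
    (hp : ∀ i < p, ¬ (m : ℤ) ∣ d * (k + 1 + i)) :
    v (quarticTerm q d t k + quarticTerm q d t (k + p)) ≤ ε := by
  have hq := h.q_ne_zero
  set w : ℤ := t + d * (2 * k + p) with hwdef
  set a := qPoch (q ^ t) (q ^ (d : ℤ)) k / qPoch (q ^ (d : ℤ)) (q ^ (d : ℤ)) k with ha
  set ρ' := ∏ i ∈ range p, (1 - q ^ (w - d * (k + 1 + i))) / (1 - q ^ ((d : ℤ) * (k + 1 + i)))
    with hρ'
  have ha1 : v a ≤ 1 := h.map_qPoch_div_le_one hd hmd hρ k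
  have hstep : qPoch (q ^ t) (q ^ (d : ℤ)) (k + p) / qPoch (q ^ (d : ℤ)) (q ^ (d : ℤ)) (k + p) =
      a * ρ' := by
    rw [ha, hρ', Finset.prod_div_distrib]
    simp only [qPoch_zpow hq, Finset.prod_range_add]
    rw [mul_div_mul_comm]
    congr 2
    · rw [← Finset.prod_range_reflect]
      refine Finset.prod_congr rfl fun i hi => ?_
      have hi := Finset.mem_range.mp hi
      congr 2
      have : ((p - 1 - i : ℕ) : ℤ) = p - 1 - i := by omega
      push_cast [this]
      rw [hwdef]
      ring
    · refine Finset.prod_congr rfl fun i _ => ?_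
      congr 2
      push_cast
      ring
  have hE : ∏ i ∈ range p, (-q ^ (-((d : ℤ) * (k + 1 + i)))) ^ 4 =
      q ^ (-(2 * (d : ℤ) * p * (2 * k + p + 1))) := by
    clear hρ' hstep hw hwdef hp
    induction p with
    | zero => simp
    | succ p ih =>
      rw [Finset.prod_range_succ, ih]
      rw [Even.neg_pow (by decide), ← zpow_natCast, ← zpow_mul, ← zpow_add₀ hq]
      congr 1
      push_cast
      ring
  have hρ4 : v (ρ' ^ 4 - q ^ (-(2 * (d : ℤ) * p * (2 * k + p + 1)))) ≤ ε := by
    rw [hρ', ← hE, Finset.prod_pow]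
    have h1 := v.map_prod_sub_prod_le (γ := ε) (k := p)
      (f := fun i => (1 - q ^ (w - d * (k + 1 + i))) / (1 - q ^ ((d : ℤ) * (k + 1 + i))))
      (g := fun i => -q ^ (-((d : ℤ) * (k + 1 + i))))
      (fun i hi => by
        rw [map_div₀, h.map_of_not_dvd _ (hp i hi), div_one]
        exact h.map_le_one _)
      (fun i _ => by rw [Valuation.map_neg, h.map_zpow])
      (fun i hi => h.map_div_add_le hw (hp i hi))
    have hx : v (∏ i ∈ range p, (1 - q ^ (w - d * (k + 1 + i))) /
        (1 - q ^ ((d : ℤ) * (k + 1 + i)))) ≤ 1 := by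
      rw [map_prod]
      refine Finset.prod_le_one' fun i hi => ?_
      rw [map_div₀, h.map_of_not_dvd _ (hp i (Finset.mem_range.mp hi)), div_one]
      exact h.map_le_one _
    have hy : v (∏ i ∈ range p, -q ^ (-((d : ℤ) * (k + 1 + i)))) ≤ 1 := by
      rw [map_prod]
      refine Finset.prod_le_one' fun i _ => ?_
      rw [Valuation.map_neg, h.map_zpow]
    have h4 := v.map_prod_sub_prod_le (γ := ε) (k := 4) (fun _ _ => hx) (fun _ _ => hy)
      fun _ _ => h1
    simpa only [Finset.prod_const, Finset.card_range] using h4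
  have hbr : v (q ^ (-(2 * (d : ℤ) * p * (2 * k + p + 1))) *
      ((1 - q ^ (2 * (d : ℤ) * (k + p : ℕ) + t)) * q ^ (((d : ℤ) - 2 * t) * (k + p : ℕ))) +
      (1 - q ^ (2 * (d : ℤ) * k + t)) * q ^ (((d : ℤ) - 2 * t) * k)) ≤ ε := by
    have key : q ^ (-(2 * (d : ℤ) * p * (2 * k + p + 1))) *
      ((1 - q ^ (2 * (d : ℤ) * (k + p : ℕ) + t)) * q ^ (((d : ℤ) - 2 * t) * (k + p : ℕ))) +
      (1 - q ^ (2 * (d : ℤ) * k + t)) * q ^ (((d : ℤ) - 2 * t) * k) =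
      q ^ (((d : ℤ) - 2 * t) * k) * ((1 - q ^ (w * (1 - 2 * p))) -
        q ^ (2 * (d : ℤ) * k + t) * (1 - q ^ (w * (-(1 + 2 * p))))) := by
      have e1 : q ^ (-(2 * (d : ℤ) * p * (2 * k + p + 1))) *
          q ^ (((d : ℤ) - 2 * t) * (k + p : ℕ)) =
          q ^ (((d : ℤ) - 2 * t) * k) * (q ^ (2 * (d : ℤ) * k + t) *
            q ^ (w * (-(1 + 2 * p)))) := by
        simp only [← zpow_add₀ hq]
        congr 1
        rw [hwdef]
        push_cast
        ring
      have e2 : q ^ (2 * (d : ℤ) * k + t) * q ^ (w * (-(1 + 2 * p))) *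
          q ^ (2 * (d : ℤ) * (k + p : ℕ) + t) = q ^ (w * (1 - 2 * p)) := by
        simp only [← zpow_add₀ hq]
        congr 1
        rw [hwdef]
        push_cast
        ring
      linear_combination (1 - q ^ (2 * (d : ℤ) * (k + p : ℕ) + t)) * e1 -
        q ^ (((d : ℤ) - 2 * t) * k) * e2
    rw [key, map_mul, h.map_zpow, one_mul]
    refine v.map_sub_le ?_ ?_
    · exact h.map_le_of_dvd (hw.mul_right _)
    · rw [map_mul, h.map_zpow, one_mul]
      exact h.map_le_of_dvd (hw.mul_right _)
  have hfin : quarticTerm q d t k + quarticTerm q d t (k + p) =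
      a ^ 4 / (1 - q) * ((ρ' ^ 4 - q ^ (-(2 * (d : ℤ) * p * (2 * k + p + 1)))) *
        ((1 - q ^ (2 * (d : ℤ) * (k + p : ℕ) + t)) * q ^ (((d : ℤ) - 2 * t) * (k + p : ℕ))) +
        (q ^ (-(2 * (d : ℤ) * p * (2 * k + p + 1))) *
      ((1 - q ^ (2 * (d : ℤ) * (k + p : ℕ) + t)) * q ^ (((d : ℤ) - 2 * t) * (k + p : ℕ))) +
      (1 - q ^ (2 * (d : ℤ) * k + t)) * q ^ (((d : ℤ) - 2 * t) * k))) := by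
    rw [quarticTerm_eq, quarticTerm_eq, hstep, ← ha, qInt, qInt]
    ring
  rw [hfin, map_mul, map_div₀, h.map_one_sub_q, div_one, map_pow]
  refine (mul_le_of_le_one_left' (pow_le_one' ha1 4)).trans (v.map_add_le ?_ hbr)
  rw [map_mul, map_mul, h.map_zpow, mul_one]
  exact (mul_le_of_le_one_right' (h.map_le_one _)).trans hρ4

theorem map_quarticTerm_add_le_of_mod (h : IsCyclotomicValuation v q m ε) {d : ℕ} (hd : d ≠ 0)
    (hmd : m.Coprime d) {t : ℤ} {N : ℕ} (hN : (m : ℤ) ∣ t + d * N) {k k' : ℕ} (hkk : k ≤ k')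
    (hdiv : k / m = k' / m) (hmod : k % m + k' % m = N % m) :
    v (quarticTerm q d t k + quarticTerm q d t k') ≤ ε := by
  obtain ⟨p, rfl⟩ := Nat.exists_eq_add_of_le hkk
  refine h.map_quarticTerm_add_le hd hmd hN ?_ fun i hi =>
    not_dvd_mul_of_div_eq (by have := h.one_lt; omega) hmd hdiv hi
  have := (dvd_add_mul_iff_modEq hmd hN (k + (k + p))).mpr (by
    rw [Nat.ModEq, Nat.add_mod, hmod, Nat.mod_mod])
  push_cast at this
  convert this using 3
  ring

theorem map_sum_quarticTerm_le (h : IsCyclotomicValuation v q m ε) {d : ℕ} (hd : d ≠ 0)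
    (hmd : m.Coprime d) {t : ℤ} {N : ℕ} (hN : (m : ℤ) ∣ t + d * N) :
    v (∑ k ∈ range (N + 1), quarticTerm q d t k) ≤ ε := by
  have hm : 0 < m := by have := h.one_lt; omega
  set σ : ℕ → ℕ := fun k =>
    if k % m ≤ N % m then m * (k / m) + (N % m - k % m) else k with hσ
  have hσdiv (k : ℕ) (hk : k % m ≤ N % m) : σ k / m = k / m := by
    simp only [hσ, if_pos hk]
    have := Nat.mod_lt N hm
    rw [Nat.mul_add_div hm, Nat.div_eq_of_lt (by omega : N % m - k % m < m), add_zero]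
  have hσmod (k : ℕ) (hk : k % m ≤ N % m) : σ k % m = N % m - k % m := by
    simp only [hσ, if_pos hk]
    rw [Nat.mul_add_mod, Nat.mod_eq_of_lt]
    have := Nat.mod_lt N hm
    omega
  refine v.map_sum_le_of_antisymm h.map_two (σ := σ) ?_ ?_ ?_
  · intro k hk
    simp only [Finset.mem_range, Nat.lt_succ_iff] at hk ⊢
    by_cases hk' : k % m ≤ N % m
    · have h1 : k / m ≤ N / m := Nat.div_le_div_right hk
      have h2 := Nat.mul_le_mul_left m h1
      have h3 := Nat.div_add_mod N m
      simp only [hσ, if_pos hk']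
      omega
    · simpa only [hσ, if_neg hk'] using hk
  · intro k _
    by_cases hk' : k % m ≤ N % m
    · have h3 := Nat.div_add_mod k m
      have h4 := hσdiv k hk'
      have h5 := hσmod k hk'
      have h6 : σ k % m ≤ N % m := by omega
      have h7 : σ (σ k) = m * (σ k / m) + (N % m - σ k % m) := if_pos h6
      rw [h7, h4, h5]
      omega
    · have h1 : σ k = k := if_neg hk'
      rw [h1, h1]
  · intro k _
    by_cases hk' : k % m ≤ N % m
    · have h4 := hσdiv k hk'
      have h5 := hσmod k hk'
      rcases le_total k (σ k) with hle | hle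
      · exact h.map_quarticTerm_add_le_of_mod hd hmd hN hle h4.symm (by omega)
      · rw [add_comm]
        exact h.map_quarticTerm_add_le_of_mod hd hmd hN hle h4 (by omega)
    · have h1 : σ k = k := if_neg hk'
      have h2 := h.map_quarticTerm_le hd hmd hN k
      rw [if_pos (not_le.mp hk')] at h2
      rw [h1]
      exact v.map_add_le h2 h2

theorem map_closedForm_le (h : IsCyclotomicValuation v q m ε) {d : ℕ} (hd : d ≠ 0)
    (hmd : m.Coprime d) {t s : ℤ} {n N : ℕ} (hmn : m ∣ n) (hN : (m : ℤ) ∣ t + d * N) :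
    v (qPoch (q ^ (2 * t)) (q ^ (d : ℤ)) N / qPoch (q ^ (d : ℤ)) (q ^ (d : ℤ)) N *
      qInt q n * q ^ s) ≤ ε := by
  have h2 : (m : ℤ) ∣ 2 * t + d * (2 * N : ℕ) := by
    have e : 2 * t + d * (2 * N : ℕ) = 2 * (t + d * N) := by
      push_cast
      ring
    rw [e]
    exact hN.mul_left 2
  rw [map_mul, map_mul, h.map_zpow, mul_one, qInt, map_div₀ v (1 - _), h.map_one_sub_q, div_one]
  exact (mul_le_of_le_one_left' (h.map_qPoch_div_le_one hd hmd h2 N)).trans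
    (h.map_le_of_dvd (Int.natCast_dvd_natCast.mpr hmn))

end IsCyclotomicValuation

/-- The deformation factor `(q^(t+n), q^(t-n); q^d)_k (q^d; q^d)_k² /
((q^(d+n), q^(d-n); q^d)_k (q^t; q^d)_k²)`. -/
noncomputable def deformFactor {F : Type*} [Field F] (q : F) (d : ℕ) (t n : ℤ) (k : ℕ) : F :=
  qPoch (q ^ (t + n)) (q ^ (d : ℤ)) k * qPoch (q ^ (t - n)) (q ^ (d : ℤ)) k *
      qPoch (q ^ (d : ℤ)) (q ^ (d : ℤ)) k ^ 2 /
    (qPoch (q ^ (d + n)) (q ^ (d : ℤ)) k * qPoch (q ^ (d - n)) (q ^ (d : ℤ)) k *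
      qPoch (q ^ t) (q ^ (d : ℤ)) k ^ 2)

/-- The coefficient `x / (1 - x)²` at `x = q^s`. -/
noncomputable def koebe {F : Type*} [Field F] (q : F) (s : ℤ) : F :=
  q ^ s / (1 - q ^ s) ^ 2

/-- The first-order coefficient of `deformFactor` in `(1 - q^n)² / q^n`. -/
noncomputable def deformSlope {F : Type*} [Field F] (q : F) (d : ℕ) (t : ℤ) (k : ℕ) : F :=
  ∑ j ∈ range k, (koebe q (t + d * j) - koebe q (d + d * j))

theorem one_sub_mul_koebe {F : Type*} [Field F] {q : F} (hq : q ≠ 0) (n : ℤ) {s : ℤ}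
    (hs : 1 - q ^ s ≠ 0) :
    1 - (1 - q ^ n) ^ 2 / q ^ n * koebe q s =
      (1 - q ^ (s + n)) * (1 - q ^ (s - n)) / (1 - q ^ s) ^ 2 := by
  have h2 : q ^ n ≠ 0 := zpow_ne_zero _ hq
  rw [koebe, zpow_add₀ hq, zpow_sub₀ hq]
  field_simp
  ring

theorem deformFactor_succ {F : Type*} [Field F] {q : F} (hq : q ≠ 0) (d : ℕ) (t n : ℤ) (k : ℕ)
    (h1 : 1 - q ^ (t + d * k) ≠ 0) (h2 : 1 - q ^ ((d : ℤ) + d * k) ≠ 0) :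
    deformFactor q d t n (k + 1) = deformFactor q d t n k *
      ((1 - (1 - q ^ n) ^ 2 / q ^ n * koebe q (t + d * k)) /
        (1 - (1 - q ^ n) ^ 2 / q ^ n * koebe q (d + d * k))) := by
  have e (u : ℤ) : q ^ u * (q ^ (d : ℤ)) ^ k = q ^ (u + d * k) := by
    rw [zpow_add₀ hq, zpow_mul, zpow_natCast (q ^ (d : ℤ))]
  rw [one_sub_mul_koebe hq n h1, one_sub_mul_koebe hq n h2]
  simp only [deformFactor, qPoch_succ, e]
  have e1 : t + n + d * k = t + d * k + n := by ring
  have e2 : t - n + d * k = t + d * k - n := by ring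
  have e3 : (d : ℤ) + n + d * k = d + d * k + n := by ring
  have e4 : (d : ℤ) - n + d * k = d + d * k - n := by ring
  rw [e1, e2, e3, e4, div_div_div_eq, div_mul_div_comm]
  congr 1 <;> ring

namespace IsCyclotomicValuation

variable {F Γ₀ : Type*} [Field F] [LinearOrderedCommGroupWithZero Γ₀]
  {v : Valuation F Γ₀} {q : F} {m : ℕ} {ε : Γ₀}

theorem one_sub_ne_zero_of_not_dvd (h : IsCyclotomicValuation v q m ε) {s : ℤ}
    (hs : ¬ (m : ℤ) ∣ s) : 1 - q ^ s ≠ 0 := by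
  rw [← v.ne_zero_iff, h.map_of_not_dvd s hs]
  exact one_ne_zero

theorem map_koebe (h : IsCyclotomicValuation v q m ε) {s : ℤ} (hs : ¬ (m : ℤ) ∣ s) :
    v (koebe q s) = 1 := by
  rw [koebe, map_div₀, map_pow, h.map_zpow, h.map_of_not_dvd s hs, one_pow, div_one]

theorem map_one_sub_mul_koebe (h : IsCyclotomicValuation v q m ε) {s : ℤ}
    (hs : ¬ (m : ℤ) ∣ s) : v (1 - (1 - q ^ (m : ℤ)) ^ 2 / q ^ (m : ℤ) * koebe q s) = 1 := by
  rw [one_sub_mul_koebe h.q_ne_zero _ (h.one_sub_ne_zero_of_not_dvd hs), map_div₀, map_mul,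
    map_pow, h.map_of_not_dvd _ hs, h.map_of_not_dvd, h.map_of_not_dvd]
  · simp
  · rwa [dvd_sub_self_right]
  · rwa [dvd_add_self_right]

theorem map_koebe_sub_le (h : IsCyclotomicValuation v q m ε) {w D : ℤ} (hw : (m : ℤ) ∣ w)
    (hD : ¬ (m : ℤ) ∣ D) : v (koebe q (w - D) - koebe q D) ≤ ε := by
  have hD' : ¬ (m : ℤ) ∣ w - D := by rwa [dvd_sub_right hw]
  have h1 := h.one_sub_ne_zero_of_not_dvd hD
  have h2 := h.one_sub_ne_zero_of_not_dvd hD'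
  have key : koebe q (w - D) - koebe q D =
      (q ^ (w - D) - q ^ D) * (1 - q ^ w) / ((1 - q ^ (w - D)) ^ 2 * (1 - q ^ D) ^ 2) := by
    have hw' : q ^ w = q ^ (w - D) * q ^ D := by rw [← zpow_add₀ h.q_ne_zero]; congr 1; ring
    rw [koebe, koebe, hw', div_sub_div _ _ (pow_ne_zero 2 h2) (pow_ne_zero 2 h1)]
    congr 1
    ring
  rw [key, map_div₀, map_mul, map_mul, map_pow, map_pow, h.map_of_not_dvd _ hD,
    h.map_of_not_dvd _ hD', one_pow, one_mul, div_one]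
  refine (mul_le_of_le_one_left' (v.map_sub_le ?_ ?_)).trans (h.map_le_of_dvd hw)
  · rw [h.map_zpow]
  · rw [h.map_zpow]

theorem map_slope_le_one (h : IsCyclotomicValuation v q m ε) {d : ℕ} {t : ℤ} {k : ℕ}
    (ht : ∀ j < k, ¬ (m : ℤ) ∣ t + d * j) (hd : ∀ j < k, ¬ (m : ℤ) ∣ d + d * j) :
    v (deformSlope q d t k) ≤ 1 := by
  refine v.map_sum_le fun j hj => v.map_sub_le ?_ ?_
  · rw [h.map_koebe (ht j (Finset.mem_range.mp hj))]
  · rw [h.map_koebe (hd j (Finset.mem_range.mp hj))]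

theorem map_deformFactor_sub_le (h : IsCyclotomicValuation v q m ε) {d : ℕ} {t : ℤ} {k : ℕ}
    (ht : ∀ j < k, ¬ (m : ℤ) ∣ t + d * j) (hd : ∀ j < k, ¬ (m : ℤ) ∣ d + d * j) :
    v (deformFactor q d t m k -
      (1 - (1 - q ^ (m : ℤ)) ^ 2 / q ^ (m : ℤ) * deformSlope q d t k)) ≤ ε ^ 3 := by
  have hY : v ((1 - q ^ (m : ℤ)) ^ 2 / q ^ (m : ℤ)) ≤ ε ^ 2 := by
    rw [map_div₀, map_pow, h.map_zpow, div_one]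
    exact pow_le_pow_left' (h.map_le_of_dvd dvd_rfl) 2
  induction k with
  | zero => simp [deformFactor, deformSlope, qPoch_zero]
  | succ k ih =>
    have ih := ih (fun j hj => ht j (by omega)) fun j hj => hd j (by omega)
    have ht' := ht k k.lt_succ_self
    have hd' := hd k k.lt_succ_self
    have hslope : v (deformSlope q d t k) ≤ 1 :=
      h.map_slope_le_one (fun j hj => ht j (by omega)) fun j hj => hd j (by omega)
    have va := h.map_koebe ht'
    have vb := h.map_koebe hd'
    have wa := h.map_one_sub_mul_koebe ht'
    have wb := h.map_one_sub_mul_koebe hd'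
    have hs : deformSlope q d t (k + 1) =
        deformSlope q d t k + (koebe q (t + d * k) - koebe q (d + d * k)) :=
      Finset.sum_range_succ _ _
    rw [deformFactor_succ h.q_ne_zero d t m k (h.one_sub_ne_zero_of_not_dvd ht')
      (h.one_sub_ne_zero_of_not_dvd hd'), hs]
    generalize (1 - q ^ (m : ℤ)) ^ 2 / q ^ (m : ℤ) = Y at *
    generalize koebe q (t + d * k) = a at *
    generalize koebe q (d + d * k) = b at *
    generalize deformSlope q d t k = g at *
    generalize deformFactor q d t m k = e at *
    have hb : 1 - Y * b ≠ 0 := by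
      rw [← v.ne_zero_iff, wb]; exact one_ne_zero
    have key : e * ((1 - Y * a) / (1 - Y * b)) - (1 - Y * (g + (a - b))) =
        (e - (1 - Y * g)) * ((1 - Y * a) / (1 - Y * b)) +
          Y * Y * ((a - b) * (g - b)) / (1 - Y * b) := by
      field_simp
      ring
    rw [key]
    refine v.map_add_le ?_ ?_
    · rw [map_mul, map_div₀, wa, wb, div_one, mul_one]
      exact ih
    · rw [map_div₀, wb, div_one, map_mul, map_mul, map_mul]
      have h1 : v (a - b) ≤ 1 := v.map_sub_le va.le vb.le
      have h2 : v (g - b) ≤ 1 := v.map_sub_le hslope vb.le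
      calc v Y * v Y * (v (a - b) * v (g - b)) ≤ ε ^ 2 * ε ^ 2 * (1 * 1) := by gcongr
        _ = ε ^ 3 * ε := by rw [mul_one, mul_one, ← pow_add, ← pow_succ]
        _ ≤ ε ^ 3 := mul_le_of_le_one_right' h.le_one

theorem map_slope_sub_le (h : IsCyclotomicValuation v q m ε) {d : ℕ} {t : ℤ} {k p : ℕ}
    (hw : (m : ℤ) ∣ t + d * (2 * k + p)) (hp : ∀ i < p, ¬ (m : ℤ) ∣ d * (k + 1 + i)) :
    v (deformSlope q d t (k + p) - deformSlope q d t k) ≤ ε := by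
  have key : deformSlope q d t (k + p) - deformSlope q d t k =
      ∑ i ∈ range p, (koebe q (t + d * (2 * k + p) - d * (k + 1 + i)) -
        koebe q (d * (k + 1 + i))) := by
    rw [deformSlope, deformSlope, Finset.sum_range_add, add_sub_cancel_left,
      Finset.sum_sub_distrib, Finset.sum_sub_distrib]
    congr 1
    · rw [← Finset.sum_range_reflect]
      refine Finset.sum_congr rfl fun i hi => ?_
      have hi := Finset.mem_range.mp hi
      have : ((p - 1 - i : ℕ) : ℤ) = p - 1 - i := by omega
      push_cast [this]
      congr 1
      ring
    · refine Finset.sum_congr rfl fun i _ => ?_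
      congr 1
      push_cast
      ring
  rw [key]
  exact v.map_sum_le fun i hi => h.map_koebe_sub_le hw (hp i (Finset.mem_range.mp hi))

theorem map_sum_sub_sum_deform_le (h : IsCyclotomicValuation v q m ε) {d : ℕ} (hd : d ≠ 0)
    (hmd : m.Coprime d) {t : ℤ} {N : ℕ} (hN : t + d * N = m) (hNm : N < m) :
    v (∑ k ∈ range (N + 1), quarticTerm q d t k -
      ∑ k ∈ range (N + 1), quarticTerm q d t k * deformFactor q d t m k) ≤ ε ^ 3 := by
  have hN' : (m : ℤ) ∣ t + d * N := by rw [hN]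
  have ht (k : ℕ) (hk : k ≤ N) (j : ℕ) (hj : j < k) : ¬ (m : ℤ) ∣ t + d * j := by
    rw [dvd_add_mul_iff_modEq hmd hN', Nat.ModEq, Nat.mod_eq_of_lt hNm, Nat.mod_eq_of_lt]
    all_goals omega
  have hd' (k : ℕ) (hk : k ≤ N) (j : ℕ) (hj : j < k) : ¬ (m : ℤ) ∣ d + d * j := by
    have := not_dvd_mul_of_div_eq (k := 0) (p := N) (d := d) (by omega) hmd
      (by rw [Nat.zero_div, Nat.div_eq_of_lt (by omega)]) (i := j) (by omega)
    intro h'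
    apply this
    convert h' using 1
    push_cast
    ring
  have hslope (k : ℕ) (hk : k ≤ N) : v (deformSlope q d t k) ≤ 1 :=
    h.map_slope_le_one (ht k hk) (hd' k hk)
  have hpair (k : ℕ) (hk : k ≤ N) (hk2 : k ≤ N - k) :
      v (quarticTerm q d t k + quarticTerm q d t (N - k)) ≤ ε ∧
        v (deformSlope q d t (N - k) - deformSlope q d t k) ≤ ε := by
    have hdiv (j : ℕ) (hj : j ≤ N) : j / m = 0 := Nat.div_eq_of_lt (by omega)
    have hmod (j : ℕ) (hj : j ≤ N) : j % m = j := Nat.mod_eq_of_lt (by omega)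
    refine ⟨h.map_quarticTerm_add_le_of_mod hd hmd hN' hk2 ?_ ?_, ?_⟩
    · rw [hdiv _ hk, hdiv _ (by omega)]
    · rw [hmod _ hk, hmod _ (by omega), hmod _ le_rfl]; omega
    · obtain ⟨p, hp⟩ := Nat.exists_eq_add_of_le hk2
      rw [hp]
      refine h.map_slope_sub_le ?_ fun i hi =>
        not_dvd_mul_of_div_eq (by omega) hmd ?_ hi
      · have h2 : (2 * k + p : ℤ) = N := by omega
        rwa [h2]
      · rw [← hp, hdiv _ hk, hdiv _ (by omega)]
  have hprod (k : ℕ) (hk : k ≤ N) (hk2 : k ≤ N - k) :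
      v (quarticTerm q d t k * deformSlope q d t k +
        quarticTerm q d t (N - k) * deformSlope q d t (N - k)) ≤ ε := by
    obtain ⟨h1, h2⟩ := hpair k hk hk2
    have key : quarticTerm q d t k * deformSlope q d t k +
        quarticTerm q d t (N - k) * deformSlope q d t (N - k) =
        (quarticTerm q d t k + quarticTerm q d t (N - k)) * deformSlope q d t k +
          quarticTerm q d t (N - k) * (deformSlope q d t (N - k) - deformSlope q d t k) := by
      ring
    rw [key]
    refine v.map_add_le ?_ ?_
    · rw [map_mul]
      exact (mul_le_of_le_one_right' (hslope k hk)).trans h1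
    · rw [map_mul]
      exact (mul_le_of_le_one_left' (h.map_quarticTerm_le_one hd hmd hN' _)).trans h2
  have hsum : v (∑ k ∈ range (N + 1), quarticTerm q d t k * deformSlope q d t k) ≤ ε := by
    refine v.map_sum_le_of_antisymm h.map_two (σ := fun k => N - k) ?_ ?_ ?_
    · intro k hk
      simp only [Finset.mem_range] at hk ⊢
      omega
    · intro k hk
      simp only [Finset.mem_range] at hk ⊢
      omega
    · intro k hk
      have hk : k ≤ N := by simpa [Nat.lt_succ_iff] using hk
      rcases le_total k (N - k) with hle | hle
      · exact hprod k hk hle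
      · have := hprod (N - k) (by omega) (by omega)
        rwa [Nat.sub_sub_self hk, add_comm] at this
  have key : ∑ k ∈ range (N + 1), quarticTerm q d t k -
      ∑ k ∈ range (N + 1), quarticTerm q d t k * deformFactor q d t m k =
      (1 - q ^ (m : ℤ)) ^ 2 / q ^ (m : ℤ) *
        (∑ k ∈ range (N + 1), quarticTerm q d t k * deformSlope q d t k) -
      ∑ k ∈ range (N + 1), quarticTerm q d t k * (deformFactor q d t m k -
        (1 - (1 - q ^ (m : ℤ)) ^ 2 / q ^ (m : ℤ) * deformSlope q d t k)) := by
    rw [Finset.mul_sum, ← Finset.sum_sub_distrib, ← Finset.sum_sub_distrib]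
    refine Finset.sum_congr rfl fun k _ => ?_
    ring
  rw [key]
  refine v.map_sub_le ?_ (v.map_sum_le fun k hk => ?_)
  · rw [map_mul, map_div₀, map_pow, h.map_zpow, div_one, pow_succ ε]
    exact mul_le_mul' (pow_le_pow_left' (h.map_le_of_dvd dvd_rfl) 2) hsum
  · have hk : k ≤ N := by simpa [Nat.lt_succ_iff] using hk
    rw [map_mul]
    exact (mul_le_of_le_one_left' (h.map_quarticTerm_le_one hd hmd hN' _)).trans
      (h.map_deformFactor_sub_le (ht k hk) (hd' k hk))

end IsCyclotomicValuation

theorem sum_quarticTerm_mul_deformFactor {F : Type*} [Field F] {q : F} (hq : q ≠ 0)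
    (hne : ∀ s : ℤ, s ≠ 0 → 1 - q ^ s ≠ 0) {d : ℕ} (hd : 2 ≤ d) {t : ℤ}
    (htd : Int.gcd t (d : ℤ) = 1) {n N : ℕ} (hN : t + d * N = n) :
    ∑ k ∈ range (N + 1), quarticTerm q d t k * deformFactor q d t n k =
      qPoch (q ^ (2 * t)) (q ^ (d : ℤ)) N / qPoch (q ^ (d : ℤ)) (q ^ (d : ℤ)) N *
        qInt q (n : ℤ) * q ^ (-(t * N)) := by
  have hdt : ¬ (d : ℤ) ∣ t := by
    intro h
    have := Int.dvd_coe_gcd h dvd_rfl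
    rw [htd] at this
    have := Int.le_of_dvd (by norm_num) this
    omega
  have e (u : ℤ) (k : ℕ) : q ^ u * (q ^ (d : ℤ)) ^ k = q ^ (u + d * k) := by
    rw [zpow_add₀ hq, zpow_mul, zpow_natCast (q ^ (d : ℤ))]
  have nt (k : ℕ) : t + d * k ≠ 0 := fun h0 => hdt ⟨-k, by linear_combination h0⟩
  have nn (k : ℕ) : (d : ℤ) - n + d * k ≠ 0 := fun h0 =>
    hdt ⟨1 + k - N, by linear_combination hN - h0⟩
  have nd (k : ℕ) : (d : ℤ) + d * k ≠ 0 := by positivity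
  have h1 : ∀ k : ℕ, 1 - q ^ (d : ℤ) * (q ^ (d : ℤ)) ^ k ≠ 0 := fun k => by
    rw [e]; exact hne _ (nd k)
  have hA : ∀ k : ℕ, 1 - q ^ t * (q ^ (d : ℤ)) ^ k ≠ 0 := fun k => by
    rw [e]; exact hne _ (nt k)
  have eB : q ^ t * q ^ (d : ℤ) / q ^ (t + n) = q ^ ((d : ℤ) - n) := by
    rw [← zpow_add₀ hq, ← zpow_sub₀ hq]
    congr 1
    ring
  have eC : q ^ t * q ^ (d : ℤ) / q ^ t = q ^ (d : ℤ) :=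
    mul_div_cancel_left₀ _ (zpow_ne_zero _ hq)
  have eBC : q ^ t * q ^ (d : ℤ) / (q ^ (t + n) * q ^ t) = q ^ ((d : ℤ) - t - n) := by
    rw [← zpow_add₀ hq, ← zpow_add₀ hq, ← zpow_sub₀ hq]
    congr 1
    ring
  have hB : ∀ k : ℕ, 1 - q ^ ((d : ℤ) - n) * (q ^ (d : ℤ)) ^ k ≠ 0 := fun k => by
    rw [e]; exact hne _ (nn k)
  have key := sum_sixPhiFiveTerm (A := q ^ t) (B := q ^ (t + n)) (C := q ^ t) (p := q ^ (d : ℤ))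
    (zpow_ne_zero _ hq) (zpow_ne_zero _ hq) (zpow_ne_zero _ hq) h1
    (by rwa [eB]) (by rwa [eC]) hA N
  rw [eB, eC, eBC] at key
  have hterm (k : ℕ) : quarticTerm q d t k * deformFactor q d t n k =
      sixPhiFiveTerm (q ^ t) (q ^ (t + n)) (q ^ t) (q ^ (d : ℤ)) N k / (1 - q) := by
    have n1 := qPoch_ne_zero h1 k
    have n2 := qPoch_ne_zero hA k
    have f1 : q ^ t * ((q ^ (d : ℤ)) ^ k) ^ 2 = q ^ (2 * (d : ℤ) * k + t) := by
      rw [← pow_mul, e]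
      congr 1
      push_cast
      ring
    have f2 : ((q ^ (d : ℤ)) ^ N)⁻¹ = q ^ (t - n) := by
      rw [← zpow_natCast, ← zpow_mul, ← zpow_neg]
      congr 1
      linear_combination -hN
    have f3 : q ^ t * (q ^ (d : ℤ)) ^ (N + 1) = q ^ ((d : ℤ) + n) := by
      rw [e]
      congr 1
      push_cast
      linear_combination hN
    have f4 : (q ^ ((d : ℤ) + n) / (q ^ (t + n) * q ^ t)) ^ k = q ^ (((d : ℤ) - 2 * t) * k) := by
      rw [zpow_mul, zpow_natCast, ← zpow_add₀ hq, ← zpow_sub₀ hq]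
      congr 2
      ring
    rw [quarticTerm, deformFactor, sixPhiFiveTerm, f3, f4, f2, f1, eB, eC, qInt]
    generalize qPoch (q ^ t) (q ^ (d : ℤ)) k = a at *
    generalize qPoch (q ^ (d : ℤ)) (q ^ (d : ℤ)) k = b at *
    generalize qPoch (q ^ ((d : ℤ) + n)) (q ^ (d : ℤ)) k = c
    generalize qPoch (q ^ ((d : ℤ) - n)) (q ^ (d : ℤ)) k = f
    generalize q ^ (((d : ℤ) - 2 * t) * k) = z
    generalize 1 - q ^ (2 * (d : ℤ) * k + t) = y
    field_simp
  rw [Finset.sum_congr rfl fun k _ => hterm k, ← Finset.sum_div, key]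
  have g1 : (1 - q ^ t) * qPoch (q ^ t * q ^ (d : ℤ)) (q ^ (d : ℤ)) N =
      qPoch (q ^ t) (q ^ (d : ℤ)) N * (1 - q ^ (n : ℤ)) := by
    rw [one_sub_mul_qPoch_shift, e, hN]
  have reflect (u : ℤ) : qPoch (q ^ u) (q ^ (d : ℤ)) N =
      (∏ i ∈ range N, -q ^ (u + d * i)) * qPoch (q ^ ((d : ℤ) - u - d * N)) (q ^ (d : ℤ)) N := by
    rw [qPoch_zpow hq, qPoch_zpow hq,
      ← Finset.prod_range_reflect (fun i : ℕ => 1 - q ^ ((d : ℤ) - u - d * N + d * i)),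
      ← Finset.prod_mul_distrib]
    refine Finset.prod_congr rfl fun i hi => ?_
    have hi := Finset.mem_range.mp hi
    have h2 : ((N - 1 - i : ℕ) : ℤ) = N - 1 - i := by omega
    have h3 : (d : ℤ) - u - d * N + d * (N - 1 - i : ℕ) = -(u + d * i) := by
      rw [h2]; ring
    rw [h3, zpow_neg]
    field_simp [zpow_ne_zero (u + d * i) hq]
    ring
  have r1 := reflect t
  have r2 := reflect (2 * t)
  have s1 : (d : ℤ) - t - d * N = d - n := by linear_combination -hN
  have s2 : (d : ℤ) - 2 * t - d * N = d - t - n := by linear_combination -hN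
  rw [s1] at r1
  rw [s2] at r2
  have r3 : ∏ i ∈ range N, -q ^ (t + d * i) =
      (∏ i ∈ range N, -q ^ (2 * t + d * i)) * q ^ (-(t * N)) := by
    have h2 : q ^ (-(t * N)) = ∏ _i ∈ range N, q ^ (-t) := by
      rw [Finset.prod_const, Finset.card_range, ← zpow_natCast, ← zpow_mul, neg_mul]
    rw [h2, ← Finset.prod_mul_distrib]
    refine Finset.prod_congr rfl fun i _ => ?_
    rw [neg_mul, ← zpow_add₀ hq]
    congr 2
    ring
  rw [← mul_assoc, g1, r1, r3, r2, qInt]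
  have n3 := qPoch_ne_zero hB N
  generalize qPoch (q ^ ((d : ℤ) - n)) (q ^ (d : ℤ)) N = a at *
  generalize qPoch (q ^ (d : ℤ)) (q ^ (d : ℤ)) N = b
  generalize qPoch (q ^ ((d : ℤ) - t - n)) (q ^ (d : ℤ)) N = c
  generalize q ^ (-(t * N)) = x
  field_simp

theorem ratCongr_of_dvd_num {M : ℚ[X]} {x : RatFunc ℚ} (h : M ∣ x.num) : ratCongr M x := by
  obtain ⟨f, hf⟩ := h
  refine ⟨f, x.denom, ?_, ?_⟩
  · exact (RatFunc.isCoprime_num_denom x).of_isCoprime_of_dvd_left ⟨f, hf⟩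
  · rw [← map_mul, ← hf]
    nth_rw 1 [← RatFunc.num_div_denom x]
    exact div_mul_cancel₀ _ (RatFunc.algebraMap_ne_zero x.denom_ne_zero)

/-- The place of `ℚ(q)` attached to the `m`-th cyclotomic polynomial. -/
noncomputable def cyclotomicPlace (m : ℕ) (hm : 0 < m) :
    IsDedekindDomain.HeightOneSpectrum ℚ[X] where
  asIdeal := Ideal.span {cyclotomic m ℚ}
  isPrime := (Ideal.span_singleton_prime (cyclotomic_ne_zero m ℚ)).mpr
    (cyclotomic.irreducible_rat hm).prime
  ne_bot := by
    rw [Ne, Ideal.span_singleton_eq_bot]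
    exact cyclotomic_ne_zero m ℚ

theorem cyclotomicPlace_intValuation_le_pow_iff {m : ℕ} (hm : 0 < m) (f : ℚ[X]) (j : ℕ) :
    (cyclotomicPlace m hm).intValuation f ≤
      (cyclotomicPlace m hm).intValuation (cyclotomic m ℚ) ^ j ↔ cyclotomic m ℚ ^ j ∣ f := by
  have h : (cyclotomicPlace m hm).intValuation (cyclotomic m ℚ) = WithZero.exp (-1 : ℤ) :=
    (cyclotomicPlace m hm).intValuation_singleton (cyclotomic_ne_zero m ℚ) rfl
  rw [h, ← WithZero.exp_nsmul, nsmul_eq_mul, mul_neg_one,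
    IsDedekindDomain.HeightOneSpectrum.intValuation_le_pow_iff_dvd,
    cyclotomicPlace, Ideal.span_singleton_pow, Ideal.dvd_span_singleton]
  exact Ideal.mem_span_singleton

theorem cyclotomicPlace_intValuation_eq_one {m : ℕ} (hm : 0 < m) {f : ℚ[X]}
    (hf : ¬ cyclotomic m ℚ ∣ f) : (cyclotomicPlace m hm).intValuation f = 1 := by
  rw [IsDedekindDomain.HeightOneSpectrum.intValuation_eq_one_iff]
  rwa [cyclotomicPlace, Ideal.mem_span_singleton]

theorem pow_dvd_num_of_valuation_le {m : ℕ} (hm : 0 < m) {x : RatFunc ℚ} {j : ℕ}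
    (h : (cyclotomicPlace m hm).valuation (RatFunc ℚ) x ≤
      (cyclotomicPlace m hm).intValuation (cyclotomic m ℚ) ^ j) :
    cyclotomic m ℚ ^ j ∣ x.num := by
  rcases Nat.eq_zero_or_pos j with rfl | hj
  · simp
  rw [← RatFunc.num_div_denom x, map_div₀,
    IsDedekindDomain.HeightOneSpectrum.valuation_of_algebraMap,
    IsDedekindDomain.HeightOneSpectrum.valuation_of_algebraMap] at h
  have hden := (cyclotomicPlace m hm).intValuation_le_one x.denom
  have hden0 : 0 < (cyclotomicPlace m hm).intValuation x.denom :=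
    zero_lt_iff.mpr ((cyclotomicPlace m hm).intValuation_ne_zero _ x.denom_ne_zero)
  rw [div_le_iff₀ hden0] at h
  rw [← cyclotomicPlace_intValuation_le_pow_iff hm]
  exact h.trans (mul_le_of_le_one_right' hden)

theorem cyclotomicPlace_valuation_one_sub_pow {m : ℕ} (hm : 0 < m) {s : ℕ} (hs : 0 < s) :
    (cyclotomicPlace m hm).valuation (RatFunc ℚ) (1 - RatFunc.X ^ s) =
      if m ∣ s then (cyclotomicPlace m hm).intValuation (cyclotomic m ℚ) else 1 := by
  have h : (1 - RatFunc.X ^ s : RatFunc ℚ) = -algebraMap ℚ[X] (RatFunc ℚ) (X ^ s - 1) := by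
    simp
  rw [h, Valuation.map_neg, IsDedekindDomain.HeightOneSpectrum.valuation_of_algebraMap,
    ← prod_cyclotomic_eq_X_pow_sub_one hs, map_prod]
  have hone (i : ℕ) (hi : i ≠ m) :
      (cyclotomicPlace m hm).intValuation (cyclotomic i ℚ) = 1 := by
    refine cyclotomicPlace_intValuation_eq_one hm fun hdvd => ?_
    exact (cyclotomic.irreducible_rat hm).not_isUnit
      ((cyclotomic.isCoprime_rat hi.symm).isUnit_of_dvd hdvd)
  split_ifs with hms
  · exact Finset.prod_eq_single_of_mem m (Nat.mem_divisors.mpr ⟨hms, hs.ne'⟩)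
      fun i _ hi => hone i hi
  · refine Finset.prod_eq_one fun i hi => hone i ?_
    rintro rfl
    exact hms (Nat.dvd_of_mem_divisors hi)

theorem isCyclotomicValuation_cyclotomicPlace {m : ℕ} (hm : 1 < m) :
    IsCyclotomicValuation ((cyclotomicPlace m (by omega)).valuation (RatFunc ℚ)) RatFunc.X m
      ((cyclotomicPlace m (by omega)).intValuation (cyclotomic m ℚ)) := by
  have hm0 : 0 < m := by omega
  have hX : (cyclotomicPlace m hm0).valuation (RatFunc ℚ) RatFunc.X = 1 := by
    rw [← RatFunc.algebraMap_X, IsDedekindDomain.HeightOneSpectrum.valuation_of_algebraMap]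
    refine cyclotomicPlace_intValuation_eq_one hm0 fun hdvd => ?_
    have h1 : IsUnit (cyclotomic m ℚ) := by
      have h2 : cyclotomic m ℚ ∣ X ^ m - 1 := cyclotomic.dvd_X_pow_sub_one m ℚ
      have h3 : cyclotomic m ℚ ∣ X ^ m := hdvd.trans (dvd_pow_self X hm0.ne')
      have h4 := dvd_sub h3 h2
      rw [sub_sub_cancel] at h4
      exact isUnit_of_dvd_one h4
    exact (cyclotomic.irreducible_rat hm0).not_isUnit h1
  have habs (s : ℤ) (hs : s ≠ 0) :
      (cyclotomicPlace m hm0).valuation (RatFunc ℚ) (1 - RatFunc.X ^ s) =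
        if (m : ℤ) ∣ s then (cyclotomicPlace m hm0).intValuation (cyclotomic m ℚ) else 1 := by
    obtain ⟨a, rfl | rfl⟩ := s.eq_nat_or_neg
    · rw [zpow_natCast, cyclotomicPlace_valuation_one_sub_pow hm0 (by omega)]
      simp only [Int.natCast_dvd_natCast]
    · have h : (1 - RatFunc.X ^ (-(a : ℤ)) : RatFunc ℚ) =
          -((1 - RatFunc.X ^ a) / RatFunc.X ^ a) := by
        have hXa : (RatFunc.X : RatFunc ℚ) ^ a ≠ 0 := pow_ne_zero _ RatFunc.X_ne_zero
        rw [zpow_neg, zpow_natCast]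
        field_simp
        ring
      rw [h, Valuation.map_neg, map_div₀, map_pow, hX, one_pow, div_one,
        cyclotomicPlace_valuation_one_sub_pow hm0 (by omega)]
      simp only [dvd_neg, Int.natCast_dvd_natCast]
  refine ⟨hm, hX, ?_, ?_, ?_, ?_, ?_⟩
  · have h : (2 : RatFunc ℚ) = algebraMap ℚ[X] (RatFunc ℚ) (C 2) := by simp
    rw [h, IsDedekindDomain.HeightOneSpectrum.valuation_of_algebraMap]
    refine cyclotomicPlace_intValuation_eq_one hm0 fun hdvd => ?_
    exact (cyclotomic.irreducible_rat hm0).not_isUnit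
      (isUnit_of_dvd_unit hdvd (isUnit_C.mpr (by simp)))
  · exact (cyclotomicPlace m hm0).intValuation_le_one _
  · exact (cyclotomicPlace m hm0).intValuation_ne_zero _ (cyclotomic_ne_zero m ℚ)
  · intro s hs hms
    rw [habs s hs, if_pos hms]
  · intro s hms
    rw [habs s (by rintro rfl; simp at hms), if_neg hms]

theorem geom_sum_mul_cyclotomic_sq_dvd {n : ℕ} (hn : 1 < n) {f : ℚ[X]}
    (h : ∀ m, 1 < m → m ∣ n → cyclotomic m ℚ ∣ f) (h3 : cyclotomic n ℚ ^ 3 ∣ f) :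
    (∑ i ∈ range n, (X : ℚ[X]) ^ i) * cyclotomic n ℚ ^ 2 ∣ f := by
  rw [← prod_cyclotomic_eq_geom_sum (by omega : 0 < n),
    ← Finset.mul_prod_erase _ _ (by simp; omega : n ∈ n.divisors.erase 1), mul_right_comm,
    ← pow_succ']
  refine IsCoprime.mul_dvd ?_ h3 (Finset.prod_dvd_of_coprime ?_ ?_)
  · refine IsCoprime.prod_right fun i hi => IsCoprime.pow_left ?_
    exact cyclotomic.isCoprime_rat (Finset.ne_of_mem_erase hi).symm
  · intro i _ j _ hij
    exact cyclotomic.isCoprime_rat hij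
  · intro i hi
    simp only [Finset.mem_erase, Nat.mem_divisors] at hi
    obtain ⟨-, hi1, hi2, -⟩ := hi
    have := Nat.pos_of_dvd_of_pos hi2 (by omega)
    exact h i (by omega) hi2

/-- Generalization of Theorem 1 (Theorem 5, eq. (4.1) of the paper). -/
theorem stmt11 (n : ℕ) (hn : 1 < n) (d : ℕ) (hd : 2 ≤ d) (t : ℤ)
    (htd : Int.gcd t (d : ℤ) = 1) (hmod : (n : ℤ) ≡ t [ZMOD (d : ℤ)])
    (ht1 : (n : ℤ) + d - n * d ≤ t) (ht2 : t ≤ (n : ℤ)) :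
    let q : RatFunc ℚ := RatFunc.X
    let N : ℕ := (((n : ℤ) - t) / (d : ℤ)).toNat
    ratCongr ((∑ i ∈ Finset.range n, (X : ℚ[X]) ^ i) * cyclotomic n ℚ ^ 2)
      ((∑ k ∈ Finset.range (N + 1),
          qInt q (2 * (d : ℤ) * k + t) * qPoch (q ^ t) (q ^ (d : ℤ)) k ^ 4 /
            qPoch (q ^ (d : ℤ)) (q ^ (d : ℤ)) k ^ 4 * q ^ (((d : ℤ) - 2 * t) * k)) -
        qPoch (q ^ (2 * t)) (q ^ (d : ℤ)) N / qPoch (q ^ (d : ℤ)) (q ^ (d : ℤ)) N *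
          qInt q (n : ℤ) * q ^ (t * (t - (n : ℤ)) / (d : ℤ))) := by
  intro q N
  have hd0 : d ≠ 0 := by omega
  have hdvd : (d : ℤ) ∣ n - t := (Int.modEq_iff_dvd.mp hmod.symm)
  have hN : t + d * N = n := by
    have h1 : ((N : ℕ) : ℤ) = (n - t) / d :=
      Int.toNat_of_nonneg (Int.ediv_nonneg (by omega) (by omega))
    rw [h1, Int.mul_ediv_cancel' hdvd]
    ring
  have hNn : N < n := by
    have h1 : (d : ℤ) * N ≤ d * (n - 1) := by linarith
    have h2 := le_of_mul_le_mul_left h1 (by positivity)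
    omega
  have hnd : n.Coprime d := by
    have h1 : Int.gcd (n : ℤ) d = 1 := by
      rw [← hN, Int.gcd_add_mul_left_left, htd]
    simpa using h1
  have hexp : t * (t - (n : ℤ)) / (d : ℤ) = -(t * N) := by
    have h1 : t * (t - (n : ℤ)) = d * -(t * N) := by rw [← hN]; ring
    rw [h1, Int.mul_ediv_cancel_left _ (by exact_mod_cast hd0)]
  rw [hexp]
  refine ratCongr_of_dvd_num (geom_sum_mul_cyclotomic_sq_dvd hn ?_ ?_)
  · intro m hm hmn
    have hv := isCyclotomicValuation_cyclotomicPlace hm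
    have hmd : m.Coprime d := hnd.coprime_dvd_left hmn
    have hmN : (m : ℤ) ∣ t + d * N := by
      rw [hN]
      exact Int.natCast_dvd_natCast.mpr hmn
    rw [← pow_one (cyclotomic m ℚ)]
    refine pow_dvd_num_of_valuation_le (by omega) ?_
    rw [pow_one]
    exact Valuation.map_sub_le _ (hv.map_sum_quarticTerm_le hd0 hmd hmN)
      (hv.map_closedForm_le hd0 hmd hmn hmN)
  · have hv := isCyclotomicValuation_cyclotomicPlace hn
    refine pow_dvd_num_of_valuation_le (by omega) ?_
    rw [← sum_quarticTerm_mul_deformFactor hv.q_ne_zero (fun s hs => hv.one_sub_ne_zero hs) hd htd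
      hN]
    exact hv.map_sum_sub_sum_deform_le hd0 hnd hN hNn
end
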